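/- arXiv:2402.07176 — 2 statements merged into one kernel-verified Lean document; each statement's English description precedes it below -/
import Mathlib

section
/- (Goldston–Pintz–Yildirim, Theorem 3.3) Suppose the primes have admissible level of distribution θ for some θ > 1/2, i.e., for every A > 0 and every ε > 0 there is a constant C_{A,ε} > 0 such that ∑_{q ≤ x^{θ−ε}} max_{a : gcd(a,q)=1} |θ(x; q, a) − x/φ(q)| ≤ C_{A,ε} · x/(log x)^A for all x ≥ 2. Then there exists a constant C(θ), depending only on θ, such that for every admissible k-tuple (h_1, …, h_k) of distinct integers with k ≥ C(θ), there are infinitely many integers n for which at least two of the numbers n + h_1, …, n + h_k are prime. -/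
open Real Filter

/-- `chebyTheta x q a = ∑_{p ≤ x, p prime, p ≡ a (mod q)} log p`. -/
noncomputable def chebyTheta (x : ℝ) (q a : ℕ) : ℝ :=
  ∑ p ∈ (Finset.Iic ⌊x⌋₊).filter (fun p => p.Prime ∧ p % q = a % q), Real.log p

/-- A `k`-tuple of integers is admissible if for every prime `p` the values do not cover
all residue classes modulo `p`. -/
def AdmissibleTuple {k : ℕ} (h : Fin k → ℤ) : Prop :=
  ∀ p : ℕ, p.Prime → ∃ r : ZMod p, ∀ i, (h i : ZMod p) ≠ r

open Real Filter

namespace GPY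

lemma prod_union_inv (S T : Finset ℕ) (f : ℕ → ℝ) (hf : ∀ p ∈ S ∩ T, f p ≠ 0) :
    ∏ p ∈ S ∪ T, (f p)⁻¹ = (∏ p ∈ S, (f p)⁻¹) * (∏ p ∈ T, (f p)⁻¹) * ∏ p ∈ S ∩ T, f p := by
  have h1 := Finset.prod_union_inter (s₁ := S) (s₂ := T) (f := fun p => (f p)⁻¹)
  rw [← h1, mul_assoc, ← Finset.prod_mul_distrib]
  rw [Finset.prod_congr rfl (g := fun _ => (1:ℝ)) (fun p hp => inv_mul_cancel₀ (hf p hp))]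
  simp

lemma diag (P : Finset ℕ) (f : ℕ → ℝ) (lam : Finset ℕ → ℝ) (hf : ∀ p ∈ P, f p ≠ 0) :
    ∑ S ∈ P.powerset, ∑ T ∈ P.powerset, lam S * lam T * ∏ p ∈ S ∪ T, (f p)⁻¹ =
    ∑ U ∈ P.powerset, (∏ p ∈ U, (f p - 1)) *
      (∑ S ∈ P.powerset with U ⊆ S, lam S * ∏ p ∈ S, (f p)⁻¹) ^ 2 := by
  have h1 : ∀ S ∈ P.powerset, ∀ T ∈ P.powerset, lam S * lam T * ∏ p ∈ S ∪ T, (f p)⁻¹ =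
      ∑ U ∈ P.powerset, (∏ p ∈ U, (f p - 1)) *
        ((if U ⊆ S then lam S * ∏ p ∈ S, (f p)⁻¹ else 0) *
         (if U ⊆ T then lam T * ∏ p ∈ T, (f p)⁻¹ else 0)) := by
    intro S hS T hT
    rw [Finset.mem_powerset] at hS hT
    rw [prod_union_inv S T f (fun p hp => hf p (hS (Finset.mem_inter.1 hp).1))]
    have h2 : ∏ p ∈ S ∩ T, f p = ∑ U ∈ (S ∩ T).powerset, ∏ p ∈ U, (f p - 1) := by
      rw [← Finset.prod_add_one]
      simp
    rw [h2]
    have h3 : (S ∩ T).powerset = P.powerset.filter (fun U => U ⊆ S ∧ U ⊆ T) := by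
      ext U
      simp only [Finset.mem_powerset, Finset.mem_filter, Finset.subset_inter_iff]
      exact ⟨fun h => ⟨h.1.trans hS, h⟩, fun h => h.2⟩
    rw [h3, Finset.sum_filter, ← mul_assoc, Finset.mul_sum]
    apply Finset.sum_congr rfl
    intro U _
    by_cases hUS : U ⊆ S <;> by_cases hUT : U ⊆ T <;> simp [hUS, hUT]
    ring
  rw [Finset.sum_congr rfl (fun S hS => Finset.sum_congr rfl (h1 S hS))]
  have h4 : ∀ U ∈ P.powerset, (∏ p ∈ U, (f p - 1)) *
      (∑ S ∈ P.powerset with U ⊆ S, lam S * ∏ p ∈ S, (f p)⁻¹) ^ 2 =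
      ∑ S ∈ P.powerset, ∑ T ∈ P.powerset, (∏ p ∈ U, (f p - 1)) *
        ((if U ⊆ S then lam S * ∏ p ∈ S, (f p)⁻¹ else 0) *
         (if U ⊆ T then lam T * ∏ p ∈ T, (f p)⁻¹ else 0)) := by
    intro U _
    rw [sq, Finset.sum_filter, Finset.sum_mul_sum, Finset.mul_sum]
    simp only [Finset.mul_sum]
  rw [Finset.sum_congr rfl h4]
  conv_rhs => rw [Finset.sum_comm]
  apply Finset.sum_congr rfl; intro S _
  rw [Finset.sum_comm]

/-- sums over supersets as sums over subsets of complement -/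
lemma sum_superset (P U : Finset ℕ) (hU : U ⊆ P) (F : Finset ℕ → ℝ) :
    ∑ T ∈ P.powerset with U ⊆ T, F T = ∑ V ∈ (P \ U).powerset, F (U ∪ V) := by
  symm
  refine Finset.sum_nbij' (fun V => U ∪ V) (fun T => T \ U) ?_ ?_ ?_ ?_ ?_
  · intro V hV
    simp only [Finset.mem_powerset, Finset.mem_filter] at *
    exact ⟨Finset.union_subset hU (hV.trans Finset.sdiff_subset), Finset.subset_union_left⟩
  · intro T hT
    simp only [Finset.mem_powerset, Finset.mem_filter] at *
    exact Finset.sdiff_subset_sdiff hT.1 le_rfl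
  · intro V hV
    simp only [Finset.mem_powerset] at hV
    have : Disjoint U V := by
      rw [Finset.disjoint_left]; intro a ha hb
      exact (Finset.mem_sdiff.1 (hV hb)).2 ha
    rw [Finset.union_sdiff_cancel_left this]
  · intro T hT
    simp only [Finset.mem_filter] at hT
    exact Finset.union_sdiff_of_subset hT.2
  · intro V _; rfl

lemma disj_of_sub {P U V : Finset ℕ} (hV : V ∈ (P \ U).powerset) : Disjoint U V := by
  rw [Finset.disjoint_left]; intro a ha hb
  exact (Finset.mem_sdiff.1 (Finset.mem_powerset.1 hV hb)).2 ha

lemma lam_sum (P : Finset ℕ) (y : Finset ℕ → ℝ) (a c g : ℕ → ℝ) (U : Finset ℕ) (hU : U ⊆ P) :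
    ∑ S ∈ P.powerset with U ⊆ S, ((∏ p ∈ S, (-(a p))) *
      ∑ T ∈ P.powerset with S ⊆ T, y T * ∏ p ∈ T, c p) * ∏ p ∈ S, g p =
    (∏ p ∈ U, (-(a p) * g p * c p)) *
      ∑ V ∈ (P \ U).powerset, y (U ∪ V) * ∏ p ∈ V, ((1 - a p * g p) * c p) := by
  have h1 : ∀ S ∈ P.powerset.filter (fun S => U ⊆ S), ((∏ p ∈ S, (-(a p))) *
      ∑ T ∈ P.powerset with S ⊆ T, y T * ∏ p ∈ T, c p) * ∏ p ∈ S, g p =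
      ∑ T ∈ P.powerset with S ⊆ T, (∏ p ∈ S, (-(a p) * g p)) * (y T * ∏ p ∈ T, c p) := by
    intro S _
    rw [← Finset.mul_sum, Finset.prod_mul_distrib]; ring
  rw [Finset.sum_congr rfl h1]
  rw [Finset.sum_comm' (t' := P.powerset.filter (fun T => U ⊆ T))
    (s' := fun T => T.powerset.filter (fun S => U ⊆ S))]
  · rw [sum_superset P U hU, Finset.mul_sum]
    apply Finset.sum_congr rfl
    intro V hV
    have hd := disj_of_sub hV
    rw [← Finset.sum_mul, sum_superset (U ∪ V) U Finset.subset_union_left,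
      Finset.union_sdiff_cancel_left hd, Finset.prod_union hd]
    have h2 : ∑ x ∈ V.powerset, ∏ p ∈ U ∪ x, (-(a p) * g p) =
        (∏ p ∈ U, (-(a p) * g p)) * ∏ p ∈ V, (1 - a p * g p) := by
      have : ∏ p ∈ V, (1 - a p * g p) = ∏ p ∈ V, (-(a p) * g p + 1) := by
        apply Finset.prod_congr rfl; intros; ring
      rw [this, Finset.prod_add_one, Finset.mul_sum]
      apply Finset.sum_congr rfl
      intro x hx
      rw [Finset.prod_union (hd.mono_right (Finset.mem_powerset.1 hx))]
    rw [h2, Finset.prod_mul_distrib (s := V),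
      Finset.prod_mul_distrib (s := U) (f := fun p => -(a p) * g p)]
    ring
  · intro S T
    simp only [Finset.mem_filter, Finset.mem_powerset]
    constructor
    · rintro ⟨⟨a1, a2⟩, a3, a4⟩; exact ⟨⟨a4, a2⟩, a3, a2.trans a4⟩
    · rintro ⟨⟨a1, a2⟩, a3, a4⟩; exact ⟨⟨a1.trans a3, a2⟩, a3, a1⟩

/-- partial summation identity -/
lemma pow_eq_integral (L c : ℝ) (hc : 0 ≤ c) (hL : 0 ≤ L) (l : ℕ) :
    (max (L - c) 0) ^ (l + 1) =
      ∫ u in (0:ℝ)..L, (if c ≤ u then ((l:ℝ) + 1) * (L - u) ^ l else 0) := by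
  have base : ∀ a b : ℝ, ∫ u in a..b, ((l:ℝ) + 1) * (L - u) ^ l =
      (L - a) ^ (l + 1) - (L - b) ^ (l + 1) := by
    intro a b
    rw [intervalIntegral.integral_comp_sub_left (fun x => ((l:ℝ)+1) * x ^ l) L]
    rw [intervalIntegral.integral_const_mul, integral_pow]
    field_simp
  by_cases h : c ≤ L
  · rw [max_eq_left (by linarith)]
    have i1 : ∫ u in (0:ℝ)..c, (if c ≤ u then ((l:ℝ) + 1) * (L - u) ^ l else 0) = 0 := by
      rw [intervalIntegral.integral_congr_ae (g := fun _ => 0)]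
      · simp
      · have : ∀ᵐ u : ℝ, u ≠ c := by
          simp [MeasureTheory.ae_iff]
        filter_upwards [this] with u hu hu2
        rw [Set.uIoc_of_le hc] at hu2
        rw [if_neg]
        intro h'
        exact hu (le_antisymm hu2.2 h')
    have i2 : ∫ u in c..L, (if c ≤ u then ((l:ℝ) + 1) * (L - u) ^ l else 0) =
        (L - c) ^ (l+1) := by
      rw [intervalIntegral.integral_congr (g := fun u => ((l:ℝ) + 1) * (L - u) ^ l)]
      · rw [base]; simp
      · intro u hu
        rw [Set.uIcc_of_le h] at hu
        simp [hu.1]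
    have meas : ∀ a b : ℝ, IntervalIntegrable
        (fun u => (if c ≤ u then ((l:ℝ) + 1) * (L - u) ^ l else 0)) MeasureTheory.volume a b := by
      intro a b
      have hh : IntervalIntegrable (fun u : ℝ => ((l:ℝ) + 1) * (L - u) ^ l)
        MeasureTheory.volume a b := (by fun_prop : Continuous _).intervalIntegrable a b
      have : (fun u : ℝ => (if c ≤ u then ((l:ℝ) + 1) * (L - u) ^ l else 0)) =
          (Set.Ici c).indicator (fun u : ℝ => ((l:ℝ) + 1) * (L - u) ^ l) := by
        ext u; simp [Set.indicator]
      rw [this]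
      constructor
      · exact hh.1.indicator measurableSet_Ici
      · exact hh.2.indicator measurableSet_Ici
    rw [← intervalIntegral.integral_add_adjacent_intervals (meas 0 c) (meas c L), i1, i2]
    simp
  · push Not at h
    rw [max_eq_right (by linarith)]
    rw [intervalIntegral.integral_congr (g := fun _ => 0)]
    · simp
    · intro u hu
      rw [Set.uIcc_of_le hL] at hu
      simp; intro h3; linarith [hu.2]

lemma integrable_step (L c : ℝ) (l : ℕ) : IntervalIntegrable
        (fun u => (if c ≤ u then ((l:ℝ) + 1) * (L - u) ^ l else 0)) MeasureTheory.volume 0 L := by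
  have hh : IntervalIntegrable (fun u : ℝ => ((l:ℝ) + 1) * (L - u) ^ l)
    MeasureTheory.volume 0 L := (by fun_prop : Continuous _).intervalIntegrable 0 L
  have : (fun u : ℝ => (if c ≤ u then ((l:ℝ) + 1) * (L - u) ^ l else 0)) =
      (Set.Ici c).indicator (fun u : ℝ => ((l:ℝ) + 1) * (L - u) ^ l) := by
    ext u; simp [Set.indicator]
  rw [this]
  constructor
  · exact hh.1.indicator measurableSet_Ici
  · exact hh.2.indicator measurableSet_Ici

lemma ps_identity {ι : Type*} (s : Finset ι) (a c : ι → ℝ) (hc : ∀ i ∈ s, 0 ≤ c i) (L : ℝ)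
    (hL : 0 ≤ L) (l : ℕ) :
    ∑ i ∈ s, a i * (max (L - c i) 0) ^ (l + 1) =
      ∫ u in (0:ℝ)..L, ((l:ℝ) + 1) * (L - u) ^ l * ∑ i ∈ s with c i ≤ u, a i := by
  have h1 : ∀ i ∈ s, a i * (max (L - c i) 0) ^ (l + 1) = 
      ∫ u in (0:ℝ)..L, a i * (if c i ≤ u then ((l:ℝ) + 1) * (L - u) ^ l else 0) := by
    intro i hi
    rw [intervalIntegral.integral_const_mul, pow_eq_integral L (c i) (hc i hi) hL]
  rw [Finset.sum_congr rfl h1, ← intervalIntegral.integral_finsetSum]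
  · apply intervalIntegral.integral_congr
    intro u _
    simp only [Finset.sum_filter, Finset.mul_sum]
    apply Finset.sum_congr rfl
    intro i _
    split_ifs <;> ring
  · intro i _
    exact (integrable_step L (c i) l).const_mul _

lemma ps_integrable {ι : Type*} (s : Finset ι) (a c : ι → ℝ) (L : ℝ) (l : ℕ) :
    IntervalIntegrable (fun u => ((l:ℝ) + 1) * (L - u) ^ l * ∑ i ∈ s with c i ≤ u, a i)
      MeasureTheory.volume 0 L := by
  have : (fun u => ((l:ℝ) + 1) * (L - u) ^ l * ∑ i ∈ s with c i ≤ u, a i) =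
    fun u => ∑ i ∈ s, a i * (if c i ≤ u then ((l:ℝ) + 1) * (L - u) ^ l else 0) := by
    ext u
    simp only [Finset.sum_filter, Finset.mul_sum]
    apply Finset.sum_congr rfl
    intro i _
    split_ifs <;> ring
  rw [this]
  have := IntervalIntegrable.sum (f := fun i u => a i * (if c i ≤ u then ((l:ℝ) + 1) * (L - u) ^ l else 0)) s (fun i _ => (integrable_step L (c i) l).const_mul (a i))
  simpa [Finset.sum_fn] using this

lemma ps_main (α β L : ℝ) (l : ℕ) :
    ∫ u in (0:ℝ)..L, ((l:ℝ) + 1) * (L - u) ^ l * (α * u + β) =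
      α * L ^ (l + 2) / (l + 2) + β * L ^ (l + 1) := by
  have : ∫ u in (0:ℝ)..L, ((l:ℝ) + 1) * (L - u) ^ l * (α * u + β) =
      ∫ u in (0:ℝ)..L, (fun x : ℝ => ((l:ℝ) + 1) * x ^ l * (α * (L - x) + β)) (L - u) := by
    simp
  rw [this, intervalIntegral.integral_comp_sub_left
    (fun x : ℝ => ((l:ℝ) + 1) * x ^ l * (α * (L - x) + β)) L]
  have h2 : ∀ x : ℝ, ((l:ℝ) + 1) * x ^ l * (α * (L - x) + β) =
      ((l:ℝ) + 1) * (α * L + β) * x ^ l - ((l:ℝ)+1) * α * x ^ (l + 1) := by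
    intro x; ring
  simp only [h2]
  rw [intervalIntegral.integral_sub, intervalIntegral.integral_const_mul,
    intervalIntegral.integral_const_mul, integral_pow, integral_pow]
  · push_cast
    simp
    field_simp
    ring
  · exact (by fun_prop : Continuous _).intervalIntegrable _ _
  · exact (by fun_prop : Continuous _).intervalIntegrable _ _

lemma ps_upper {ι : Type*} (s : Finset ι) (a c : ι → ℝ) (hc : ∀ i ∈ s, 0 ≤ c i) (L : ℝ)
    (hL : 0 ≤ L) (l : ℕ) (hl : 1 ≤ l) (α β : ℝ)
    (h : ∀ u, 0 ≤ u → u ≤ L → ∑ i ∈ s with c i ≤ u, a i ≤ α * u + β) :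
    ∑ i ∈ s, a i * (max (L - c i) 0) ^ l ≤ α * L ^ (l + 1) / (l + 1) + β * L ^ l := by
  obtain ⟨m, rfl⟩ : ∃ m, l = m + 1 := ⟨l - 1, by omega⟩
  rw [ps_identity s a c hc L hL m]
  have := ps_main α β L m
  have e : α * L ^ (m + 1 + 1) / (((m + 1 : ℕ) : ℝ) + 1) + β * L ^ (m + 1) =
    α * L ^ (m + 2) / (m + 2) + β * L ^ (m + 1) := by
      push_cast; ring
  rw [e, ← this]
  apply intervalIntegral.integral_mono_on hL (ps_integrable s a c L m)
  · exact (by fun_prop : Continuous _).intervalIntegrable _ _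
  · intro u hu
    exact mul_le_mul_of_nonneg_left (h u hu.1 hu.2)
      (mul_nonneg (by positivity) (pow_nonneg (by linarith [hu.2]) _))

lemma ps_lower {ι : Type*} (s : Finset ι) (a c : ι → ℝ) (hc : ∀ i ∈ s, 0 ≤ c i) (L : ℝ)
    (hL : 0 ≤ L) (l : ℕ) (hl : 1 ≤ l) (α : ℝ)
    (h : ∀ u, 0 ≤ u → u ≤ L → α * u ≤ ∑ i ∈ s with c i ≤ u, a i) :
    α * L ^ (l + 1) / (l + 1) ≤ ∑ i ∈ s, a i * (max (L - c i) 0) ^ l := by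
  obtain ⟨m, rfl⟩ : ∃ m, l = m + 1 := ⟨l - 1, by omega⟩
  rw [ps_identity s a c hc L hL m]
  have := ps_main α 0 L m
  have e : α * L ^ (m + 1 + 1) / (((m + 1 : ℕ) : ℝ) + 1) =
    α * L ^ (m + 2) / (m + 2) + 0 * L ^ (m + 1) := by
      push_cast; ring
  rw [e, ← this]
  apply intervalIntegral.integral_mono_on hL _ (ps_integrable s a c L m)
  · intro u hu
    exact mul_le_mul_of_nonneg_left (by simpa using h u hu.1 hu.2)
      (mul_nonneg (by positivity) (pow_nonneg (by linarith [hu.2]) _))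
  · exact (by fun_prop : Continuous _).intervalIntegrable _ _

end GPY

open Real Filter

namespace GPY

noncomputable def ell (S : Finset ℕ) : ℝ := ∑ p ∈ S, Real.log p

lemma ell_nonneg (S : Finset ℕ) : 0 ≤ ell S :=
  Finset.sum_nonneg fun p _ => Real.log_natCast_nonneg p

lemma ell_union {S T : Finset ℕ} (h : Disjoint S T) : ell (S ∪ T) = ell S + ell T :=
  Finset.sum_union h

lemma ell_mono {S T : Finset ℕ} (h : S ⊆ T) : ell S ≤ ell T :=
  Finset.sum_le_sum_of_subset_of_nonneg h fun p _ _ => Real.log_natCast_nonneg p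

lemma prod_ne_zero_of_prime {S : Finset ℕ} (hS : ∀ p ∈ S, p.Prime) : ∏ p ∈ S, p ≠ 0 :=
  Finset.prod_ne_zero_iff.2 fun p hp => (hS p hp).ne_zero

lemma ell_eq_log {S : Finset ℕ} (hS : ∀ p ∈ S, p.Prime) : ell S = Real.log ((∏ p ∈ S, p : ℕ) : ℝ) := by
  rw [Nat.cast_prod, Real.log_prod (fun p hp => by exact_mod_cast (hS p hp).ne_zero)]
  rfl

lemma ell_le_iff {S : Finset ℕ} (hS : ∀ p ∈ S, p.Prime) (u : ℝ) :
    ell S ≤ u ↔ ∏ p ∈ S, p ≤ ⌊Real.exp u⌋₊ := by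
  have h0 : (0:ℝ) < ((∏ p ∈ S, p : ℕ) : ℝ) := by
    exact_mod_cast Nat.pos_of_ne_zero (prod_ne_zero_of_prime hS)
  rw [ell_eq_log hS, Nat.le_floor_iff (Real.exp_pos u).le, Real.log_le_iff_le_exp h0]

lemma harm_upper (u : ℝ) (hu : 0 ≤ u) : ∑ n ∈ Finset.Icc 1 ⌊Real.exp u⌋₊, (n:ℝ)⁻¹ ≤ 1 + u := by
  have h1 := harmonic_floor_le_one_add_log (Real.exp u) (Real.one_le_exp hu)
  rw [harmonic_eq_sum_Icc] at h1
  push_cast at h1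
  simpa using h1

lemma harm_lower (u : ℝ) : u ≤ ∑ n ∈ Finset.Icc 1 ⌊Real.exp u⌋₊, (n:ℝ)⁻¹ := by
  have h1 := log_add_one_le_harmonic ⌊Real.exp u⌋₊
  rw [harmonic_eq_sum_Icc] at h1
  push_cast at h1
  refine le_trans ?_ h1
  rw [Real.le_log_iff_exp_le (by positivity)]
  exact (Nat.lt_floor_add_one _).le

lemma euler_fin (Q : Finset ℕ) (hQ : ∀ p ∈ Q, p.Prime) (s : Finset ℕ)
    (hs : ∀ m ∈ s, m ∈ Nat.factoredNumbers Q) :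
    ∑ m ∈ s, (m:ℝ)⁻¹ ≤ ∏ p ∈ Q, (1 - (p:ℝ)⁻¹)⁻¹ := by
  let f : ℕ →* ℝ := (invMonoidWithZeroHom : ℝ →*₀ ℝ).toMonoidHom.comp (Nat.castRingHom ℝ).toMonoidHom
  have hf : ∀ n : ℕ, f n = (n:ℝ)⁻¹ := fun n => rfl
  have h := (EulerProduct.summable_and_hasSum_factoredNumbers_prod_filter_prime_geometric (f := f)
    (fun {p} hp => by
      rw [hf, Real.norm_of_nonneg (by positivity)]
      exact inv_lt_one_of_one_lt₀ (by exact_mod_cast hp.one_lt)) Q).2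
  rw [Finset.filter_true_of_mem hQ] at h
  have h2 := sum_le_hasSum (s.subtype (· ∈ Nat.factoredNumbers Q)) (fun i _ => by rw [hf]; positivity) h
  simp only [hf] at h2
  rwa [Finset.sum_subtype_of_mem (fun m : ℕ => (m:ℝ)⁻¹) hs] at h2

lemma one_sub_inv_pos {p : ℕ} (hp : p.Prime) : 0 < 1 - (p:ℝ)⁻¹ := by
  have : (1:ℝ) < p := by exact_mod_cast hp.one_lt
  have := inv_lt_one_of_one_lt₀ this
  linarith

lemma euler_lower (Q P : Finset ℕ) (hQ : ∀ p ∈ Q, p.Prime) (hP : ∀ p ∈ P, p.Prime)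
    (hd : Disjoint Q P) (u : ℝ)
    (hc : ∀ p : ℕ, p.Prime → (p:ℝ) ≤ Real.exp u → p ∈ Q ∪ P) :
    (∏ p ∈ Q, (1 - (p:ℝ)⁻¹)) * u ≤
      ∑ V ∈ P.powerset with ell V ≤ u, ∏ p ∈ V, ((p:ℝ) - 1)⁻¹ := by
  have hpos : 0 < ∏ p ∈ Q, (1 - (p:ℝ)⁻¹) := Finset.prod_pos fun p hp => one_sub_inv_pos (hQ p hp)
  rw [← le_div_iff₀' hpos, div_eq_inv_mul, ← Finset.prod_inv_distrib]
  refine (harm_lower u).trans ?_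
  have key : ∀ n ∈ Finset.Icc 1 ⌊Real.exp u⌋₊, n.primeFactors ∩ P ∈
      P.powerset.filter (fun V => ell V ≤ u) := by
    intro n hn
    rw [Finset.mem_Icc] at hn
    rw [Finset.mem_filter, Finset.mem_powerset]
    refine ⟨Finset.inter_subset_right, ?_⟩
    rw [ell_le_iff (fun p hp => hP p (Finset.mem_inter.1 hp).2)]
    refine le_trans (Nat.le_of_dvd (by omega) ?_) hn.2
    exact (Finset.prod_dvd_prod_of_subset _ _ _ Finset.inter_subset_left).trans
      (Nat.prod_primeFactors_dvd n)
  rw [← Finset.sum_fiberwise_of_maps_to key, Finset.mul_sum]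
  apply Finset.sum_le_sum
  intro V hV
  rw [Finset.mem_filter, Finset.mem_powerset] at hV
  have hVp : ∀ p ∈ V, p.Prime := fun p hp => hP p (hV.1 hp)
  have hdV : Disjoint Q V := hd.mono_right hV.1
  set m0 := ∏ p ∈ V, p with hm0
  have hm0pos : 0 < m0 := Nat.pos_of_ne_zero (prod_ne_zero_of_prime hVp)
  set s := (Finset.Icc 1 ⌊Real.exp u⌋₊).filter (fun n => n.primeFactors ∩ P = V) with hs
  have hdvd : ∀ n ∈ s, m0 ∣ n := by
    intro n hn
    rw [hs, Finset.mem_filter] at hn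
    rw [hm0, ← hn.2]
    exact (Finset.prod_dvd_prod_of_subset _ _ _ Finset.inter_subset_left).trans
      (Nat.prod_primeFactors_dvd n)
  have e1 : ∑ n ∈ s, (n:ℝ)⁻¹ = (m0:ℝ)⁻¹ * ∑ m ∈ s.image (fun n => n / m0), (m:ℝ)⁻¹ := by
    rw [Finset.sum_image, Finset.mul_sum]
    · apply Finset.sum_congr rfl
      intro n hn
      rw [Nat.cast_div (hdvd n hn) (by positivity), ← mul_inv, mul_div_cancel₀]
      positivity
    · intro a ha b hb hab
      have := Nat.div_mul_cancel (hdvd a ha)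
      have h2 := Nat.div_mul_cancel (hdvd b hb)
      simp only at hab
      rw [← this, ← h2, hab]
  rw [e1]
  have e2 := euler_fin (Q ∪ V) (fun p hp => (Finset.mem_union.1 hp).elim (hQ p) (hVp p))
    (s.image (fun n => n / m0)) (by
      intro m hm
      rw [Finset.mem_image] at hm
      obtain ⟨n, hn, rfl⟩ := hm
      have hdn := hdvd n hn
      rw [hs, Finset.mem_filter, Finset.mem_Icc] at hn
      apply Nat.mem_factoredNumbers_of_dvd (m := n) _ (Nat.div_dvd_of_dvd hdn)
      rw [Nat.mem_factoredNumbers_iff_primeFactors_subset]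
      refine ⟨by omega, ?_⟩
      intro p hp
      have hpp := Nat.prime_of_mem_primeFactors hp
      have hpn : p ≤ n := Nat.le_of_mem_primeFactors hp
      have := hc p hpp ((Nat.le_floor_iff (Real.exp_pos u).le).1 (hpn.trans hn.1.2))
      rw [Finset.mem_union] at this ⊢
      rcases this with h | h
      · exact Or.inl h
      · right; rw [← hn.2]; exact Finset.mem_inter.2 ⟨hp, h⟩)
  rw [Finset.prod_union hdV] at e2
  calc _ ≤ (m0:ℝ)⁻¹ * ((∏ p ∈ Q, (1 - (p:ℝ)⁻¹)⁻¹) * ∏ p ∈ V, (1 - (p:ℝ)⁻¹)⁻¹) := by gcongr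
    _ = _ := by
      rw [hm0, Nat.cast_prod, mul_left_comm, ← Finset.prod_inv_distrib, ← Finset.prod_mul_distrib]
      congr 1
      apply Finset.prod_congr rfl
      intro p hp
      have : (0:ℝ) < p := by exact_mod_cast (hVp p hp).pos
      rw [← mul_inv]
      congr 1
      field_simp

lemma coprime_harm (W : ℕ) (hW : 0 < W) (u : ℝ) (hu : 0 ≤ u) :
    ∑ n ∈ Finset.Icc 1 ⌊Real.exp u⌋₊ with W.Coprime n, (n:ℝ)⁻¹ ≤
      (W.totient : ℝ) / W * u + (W + 1) := by
  set M := ⌊Real.exp u⌋₊ with hM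
  have hW' : (0:ℝ) < W := by exact_mod_cast hW
  have hsplit : ∑ n ∈ Finset.Icc 1 M with W.Coprime n, (n:ℝ)⁻¹ ≤
      ∑ n ∈ Finset.range W, (1:ℝ) +
      ∑ n ∈ (Finset.Icc 1 M).biUnion (fun m => (Finset.Ico (W * m) (W * m + W)).filter (fun n => W.Coprime n)),
        ((W:ℝ) * ((n / W : ℕ) : ℝ))⁻¹ := by
    have : (Finset.Icc 1 M).filter (fun n => W.Coprime n) ⊆
      ((Finset.Icc 1 M).filter (fun n => W.Coprime n ∧ n < W)) ∪
      ((Finset.Icc 1 M).filter (fun n => W.Coprime n ∧ W ≤ n)) := by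
      intro n hn
      simp only [Finset.mem_filter, Finset.mem_union] at *
      rcases lt_or_ge n W with h | h
      · left; exact ⟨hn.1, hn.2, h⟩
      · right; exact ⟨hn.1, hn.2, h⟩
    refine (Finset.sum_le_sum_of_subset_of_nonneg this (fun _ _ _ => by positivity)).trans ?_
    rw [Finset.sum_union (by
      rw [Finset.disjoint_left]; intro a ha hb
      simp only [Finset.mem_filter] at ha hb; omega)]
    refine add_le_add ?_ ?_
    · refine (Finset.sum_le_sum (g := fun _ => (1:ℝ)) ?_).trans
        (Finset.sum_le_sum_of_subset_of_nonneg ?_ (fun _ _ _ => by positivity))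
      · intro n hn
        simp only [Finset.mem_filter, Finset.mem_Icc] at hn
        exact inv_le_one_of_one_le₀ (by exact_mod_cast hn.1.1)
      · intro n hn
        simp only [Finset.mem_filter, Finset.mem_Icc] at hn
        simp [hn.2.2]
    · refine (Finset.sum_le_sum (g := fun n => ((W:ℝ) * ((n / W : ℕ) : ℝ))⁻¹) ?_).trans
        (Finset.sum_le_sum_of_subset_of_nonneg ?_ (fun _ _ _ => by positivity))
      · intro n hn
        simp only [Finset.mem_filter, Finset.mem_Icc] at hn
        have h1 : 0 < n / W := Nat.div_pos hn.2.2 hW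
        apply inv_anti₀ (by positivity)
        exact_mod_cast Nat.mul_div_le n W
      · intro n hn
        simp only [Finset.mem_filter, Finset.mem_Icc, Finset.mem_biUnion, Finset.mem_Ico] at *
        refine ⟨n / W, ⟨Nat.div_pos hn.2.2 hW, (Nat.div_le_self n W).trans hn.1.2⟩, ⟨Nat.mul_div_le n W, ?_⟩, hn.2.1⟩
        have := Nat.div_add_mod n W
        have := Nat.mod_lt n hW
        omega
  refine hsplit.trans ?_
  have hb : ∑ n ∈ (Finset.Icc 1 M).biUnion (fun m => (Finset.Ico (W * m) (W * m + W)).filter (fun n => W.Coprime n)),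
        ((W:ℝ) * ((n / W : ℕ) : ℝ))⁻¹ = ∑ m ∈ Finset.Icc 1 M, (W.totient : ℝ) / W * (m:ℝ)⁻¹ := by
    have hdiv : ∀ m n, n ∈ (Finset.Ico (W * m) (W * m + W)).filter (fun n => W.Coprime n) → n / W = m := by
      intro m n hn
      simp only [Finset.mem_filter, Finset.mem_Ico] at hn
      apply Nat.div_eq_of_lt_le
      · rw [mul_comm]; exact hn.1.1
      · rw [mul_comm, mul_add, mul_one]; exact hn.1.2
    rw [Finset.sum_biUnion]
    · apply Finset.sum_congr rfl
      intro m _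
      rw [Finset.sum_congr rfl (g := fun _ => ((W:ℝ) * (m:ℝ))⁻¹) (fun n hn => by rw [hdiv m n hn])]
      rw [Finset.sum_const, Nat.filter_coprime_Ico_eq_totient]
      rw [nsmul_eq_mul, mul_inv, div_eq_mul_inv, mul_assoc]
    · intro a _ b _ hab
      rw [Function.onFun, Finset.disjoint_left]
      intro n h1 h2
      exact hab ((hdiv a n h1).symm.trans (hdiv b n h2))
  rw [hb, ← Finset.mul_sum]
  have h3 := harm_upper u hu
  have h4 : (W.totient : ℝ) / W ≤ 1 := by
    rw [div_le_one hW']; exact_mod_cast Nat.totient_le W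
  have h5 : (0:ℝ) ≤ (W.totient : ℝ) / W := by positivity
  simp only [Finset.sum_const, Finset.card_range, nsmul_eq_mul, mul_one]
  rw [← hM] at h3
  nlinarith [mul_le_mul_of_nonneg_left h3 h5]

/-- squarefree sums bounded by sums over integers -/
lemma sqfree_le (P : Finset ℕ) (hP : ∀ p ∈ P, p.Prime) (W : ℕ) (hW : ∀ p ∈ P, W.Coprime p) (u : ℝ) :
    ∑ V ∈ P.powerset with ell V ≤ u, ∏ p ∈ V, (p:ℝ)⁻¹ ≤
     ∑ n ∈ Finset.Icc 1 ⌊Real.exp u⌋₊ with W.Coprime n, (n:ℝ)⁻¹ := by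
  have hVp : ∀ V ∈ P.powerset, ∀ p ∈ V, p.Prime := fun V hV p hp => hP p (Finset.mem_powerset.1 hV hp)
  have : ∑ V ∈ P.powerset with ell V ≤ u, ∏ p ∈ V, (p:ℝ)⁻¹ =
      ∑ n ∈ (P.powerset.filter (fun V => ell V ≤ u)).image (fun V => ∏ p ∈ V, p), (n:ℝ)⁻¹ := by
    rw [Finset.sum_image]
    · apply Finset.sum_congr rfl
      intro V _
      rw [Nat.cast_prod, Finset.prod_inv_distrib]
    · intro A hA B hB hAB
      simp only [Finset.coe_filter, Set.mem_ofPred_eq] at hA hB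
      simp only at hAB
      rw [← Nat.primeFactors_prod (hVp A hA.1), hAB, Nat.primeFactors_prod (hVp B hB.1)]
  rw [this]
  apply Finset.sum_le_sum_of_subset_of_nonneg _ (fun _ _ _ => by positivity)
  intro n hn
  simp only [Finset.mem_image, Finset.mem_filter, Finset.mem_Icc] at *
  obtain ⟨V, ⟨hV, hu⟩, rfl⟩ := hn
  rw [ell_le_iff (hVp V hV)] at hu
  refine ⟨⟨Nat.pos_of_ne_zero (prod_ne_zero_of_prime (hVp V hV)), hu⟩, ?_⟩
  exact Nat.Coprime.prod_right (fun p hp => hW p (Finset.mem_powerset.1 hV hp))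

/-- convolution inequality -/
lemma conv_le (P : Finset ℕ) (a b : ℕ → ℝ) (ha : ∀ p ∈ P, 0 ≤ a p) (hb : ∀ p ∈ P, 0 ≤ b p)
    (F : Finset ℕ → ℝ) (G : Finset ℕ → Finset ℕ → ℝ)
    (hG : ∀ S ∈ P.powerset, ∀ T ∈ P.powerset, 0 ≤ G S T)
    (hFG : ∀ S ∈ P.powerset, ∀ T ∈ P.powerset, Disjoint S T → F (S ∪ T) ≤ G S T) :
    ∑ S ∈ P.powerset, (∏ p ∈ S, (a p + b p)) * F S ≤
      ∑ A ∈ P.powerset, (∏ p ∈ A, a p) * ∑ B ∈ P.powerset, (∏ p ∈ B, b p) * G A B := by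
  have h1 : ∀ S ∈ P.powerset, (∏ p ∈ S, (a p + b p)) * F S =
      ∑ A ∈ S.powerset, (∏ p ∈ A, a p) * (∏ p ∈ S \ A, b p) * F S := by
    intro S _
    rw [Finset.prod_add, Finset.sum_mul]
  rw [Finset.sum_congr rfl h1]
  rw [Finset.sum_comm' (t' := P.powerset) (s' := fun A => P.powerset.filter (fun S => A ⊆ S))]
  · apply Finset.sum_le_sum
    intro A hA
    have hA' := Finset.mem_powerset.1 hA
    have hA0 : 0 ≤ ∏ p ∈ A, a p := Finset.prod_nonneg fun p hp => ha p (hA' hp)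
    rw [sum_superset P A hA', Finset.mul_sum]
    have hsub : (P \ A).powerset ⊆ P.powerset := Finset.powerset_mono.2 Finset.sdiff_subset
    refine (Finset.sum_le_sum ?_).trans (Finset.sum_le_sum_of_subset_of_nonneg hsub ?_)
    · intro B hB
      have hd := disj_of_sub hB
      rw [Finset.union_sdiff_cancel_left hd, mul_assoc]
      have hB0 : 0 ≤ ∏ p ∈ B, b p := Finset.prod_nonneg fun p hp => 
        hb p (Finset.mem_powerset.1 (hsub hB) hp)
      exact mul_le_mul_of_nonneg_left (mul_le_mul_of_nonneg_left (hFG A hA B (hsub hB) hd) hB0) hA0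
    · intro B hB _
      have hB0 : 0 ≤ ∏ p ∈ B, b p := Finset.prod_nonneg fun p hp => 
        hb p (Finset.mem_powerset.1 hB hp)
      exact mul_nonneg hA0 (mul_nonneg hB0 (hG A hA B hB))
  · intro S A
    simp only [Finset.mem_filter, Finset.mem_powerset]
    constructor
    · rintro ⟨h1, h2⟩; exact ⟨⟨h1, h2⟩, h2.trans h1⟩
    · rintro ⟨⟨h1, h2⟩, h3⟩; exact ⟨h1, h2⟩

lemma sum_inv_sq (D : ℕ) (hD : 0 < D) (P : Finset ℕ) (hP : ∀ p ∈ P, D < p) :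
    ∑ p ∈ P, ((p:ℝ) ^ 2)⁻¹ ≤ 1 / D := by
  have h1 : ∀ M : ℕ, D ≤ M → ∑ p ∈ Finset.Ioc D M, ((p:ℝ) ^ 2)⁻¹ ≤ 1 / D - 1 / M := by
    intro M hM
    induction M, hM using Nat.le_induction with
    | base => simp
    | succ n hn ih =>
      rw [← Finset.insert_Ioc_right_eq_Ioc_add_one hn, Finset.sum_insert (by simp)]
      have h0 : (0:ℝ) < n := by exact_mod_cast (lt_of_lt_of_le hD hn)
      have : (((n + 1 : ℕ) : ℝ) ^ 2)⁻¹ ≤ 1 / n - 1 / ((n + 1 : ℕ) : ℝ) := by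
        push_cast
        rw [div_sub_div _ _ h0.ne' (by positivity), inv_eq_one_div, div_le_div_iff₀ (by positivity) (by positivity)]
        nlinarith
      linarith
  have hsub : P ⊆ Finset.Ioc D (D + P.sup id) := by
    intro p hp
    rw [Finset.mem_Ioc]
    refine ⟨hP p hp, ?_⟩
    have : p ≤ P.sup id := Finset.le_sup (f := id) hp
    omega
  refine (Finset.sum_le_sum_of_subset_of_nonneg hsub (fun _ _ _ => by positivity)).trans ?_
  refine (h1 _ (by omega)).trans ?_
  have : (0:ℝ) ≤ 1 / ((D + P.sup id : ℕ) : ℝ) := by positivity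
  linarith

/-- upper bound for the linear sieve-type sum -/
lemma upper_U1 (k D W : ℕ) (hW : 0 < W) (hD : 0 < D) (hk : 2 * k ≤ D) (P : Finset ℕ)
    (hP : ∀ p ∈ P, p.Prime) (hPD : ∀ p ∈ P, D < p) (hPW : ∀ p ∈ P, W.Coprime p) (u : ℝ) (hu : 0 ≤ u) :
    ∑ V ∈ P.powerset with ell V ≤ u, ∏ p ∈ V, ((p:ℝ) - k)⁻¹ ≤
      Real.exp (2 * k / D) * ((W.totient : ℝ) / W * u + (W + 1)) := by
  have hpk : ∀ p ∈ P, (p:ℝ) / 2 ≤ (p:ℝ) - k ∧ (0:ℝ) < p := by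
    intro p hp
    have h1 : (D:ℝ) < p := by exact_mod_cast hPD p hp
    have h2 : (2:ℝ) * k ≤ D := by exact_mod_cast hk
    have h3 : (0:ℝ) ≤ k := by positivity
    constructor <;> linarith
  rw [Finset.sum_filter]
  have e : ∀ V ∈ P.powerset, (if ell V ≤ u then ∏ p ∈ V, ((p:ℝ) - k)⁻¹ else 0) =
      (∏ p ∈ V, ((k:ℝ) * ((p:ℝ) * (p - k))⁻¹ + (p:ℝ)⁻¹)) * (if ell V ≤ u then 1 else 0) := by
    intro V hV
    split_ifs
    · rw [mul_one]
      apply Finset.prod_congr rfl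
      intro p hp
      obtain ⟨h1, h2⟩ := hpk p (Finset.mem_powerset.1 hV hp)
      have : (0:ℝ) < p - k := by linarith
      field_simp
      ring
    · simp
  rw [Finset.sum_congr rfl e]
  have hkp : ∀ p ∈ P, 0 ≤ (k:ℝ) * ((p:ℝ) * (p - k))⁻¹ := by
    intro p hp
    obtain ⟨h1, h2⟩ := hpk p hp
    have : (0:ℝ) < p - k := by linarith
    positivity
  refine (conv_le P _ _ hkp (fun p hp => by positivity) _
    (fun _ T => if ell T ≤ u then 1 else 0) (fun S _ T _ => by split_ifs <;> norm_num) ?_).trans ?_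
  · intro S _ T _ hd
    by_cases h : ell T ≤ u
    · rw [if_pos h]; split_ifs <;> norm_num
    · rw [if_neg h, if_neg]
      rw [ell_union hd]
      have := ell_nonneg S
      linarith
  · have h2 : ∑ B ∈ P.powerset, (∏ p ∈ B, (p:ℝ)⁻¹) * (if ell B ≤ u then 1 else 0) ≤
        (W.totient : ℝ) / W * u + (W + 1) := by
      simp only [mul_ite, mul_one, mul_zero]
      rw [← Finset.sum_filter]
      exact (sqfree_le P hP W hPW u).trans (coprime_harm W hW u hu)
    rw [← Finset.sum_mul]
    have h3 : ∑ A ∈ P.powerset, ∏ p ∈ A, (k:ℝ) * ((p:ℝ) * (p - k))⁻¹ ≤ Real.exp (2 * k / D) := by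
      rw [← Finset.prod_one_add]
      refine (Finset.prod_le_prod (fun p hp => by linarith [hkp p hp]) (fun p _ => (add_comm _ _).le.trans
        (Real.add_one_le_exp _))).trans ?_
      rw [← Real.exp_sum]
      apply Real.exp_le_exp.2
      calc _ ≤ ∑ p ∈ P, 2 * (k:ℝ) * ((p:ℝ) ^ 2)⁻¹ := by
            apply Finset.sum_le_sum
            intro p hp
            obtain ⟨h1, h2⟩ := hpk p hp
            have : ((p:ℝ) * (p - k))⁻¹ ≤ ((p:ℝ) ^ 2 / 2)⁻¹ := by
              apply inv_anti₀ (by positivity)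
              nlinarith
            calc (k:ℝ) * ((p:ℝ) * (p - k))⁻¹ ≤ k * ((p:ℝ) ^ 2 / 2)⁻¹ := by gcongr
              _ = _ := by field_simp
        _ ≤ _ := by
            rw [← Finset.mul_sum]
            calc _ ≤ 2 * (k:ℝ) * (1 / D) := by
                  have := sum_inv_sq D hD P hPD
                  gcongr
              _ = _ := by ring
    refine mul_le_mul h3 h2 ?_ (Real.exp_pos _).le
    exact Finset.sum_nonneg fun B _ => mul_nonneg (Finset.prod_nonneg fun p _ => by positivity) (by split_ifs <;> norm_num)

lemma mertens_upper (P : Finset ℕ) (hP : ∀ p ∈ P, p.Prime) (u : ℝ) (hu : 0 ≤ u) :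
    ∑ p ∈ P with Real.log (p : ℕ) ≤ u, Real.log p * (p:ℝ)⁻¹ ≤ u + Real.log 4 := by
  set M := ⌊Real.exp u⌋₊ with hM
  have hM1 : 1 ≤ M := by
    rw [hM, Nat.le_floor_iff (Real.exp_pos u).le]; simpa using hu
  have hM0 : (0:ℝ) < M := by exact_mod_cast hM1
  have hlogM : Real.log M ≤ u := by
    rw [Real.log_le_iff_le_exp hM0]; exact Nat.floor_le (Real.exp_pos u).le
  have h1 : ∑ p ∈ P with Real.log (p : ℕ) ≤ u, Real.log p * (p:ℝ)⁻¹ ≤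
      ∑ p ∈ (Finset.Ioc 0 M).filter Nat.Prime, Real.log p * (p:ℝ)⁻¹ := by
    apply Finset.sum_le_sum_of_subset_of_nonneg
    · intro p hp
      simp only [Finset.mem_filter, Finset.mem_Ioc] at *
      have hpp := hP p hp.1
      refine ⟨⟨hpp.pos, ?_⟩, hpp⟩
      rw [hM, Nat.le_floor_iff (Real.exp_pos u).le, ← Real.log_le_iff_le_exp (by exact_mod_cast hpp.pos)]
      exact hp.2
    · intro p _ _
      exact mul_nonneg (Real.log_natCast_nonneg p) (by positivity)
  refine h1.trans ?_
  have h2 : ∑ p ∈ (Finset.Ioc 0 M).filter Nat.Prime, Real.log p * ((M / p : ℕ) : ℝ) ≤ M * Real.log M := by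
    calc ∑ p ∈ (Finset.Ioc 0 M).filter Nat.Prime, Real.log p * ((M / p : ℕ) : ℝ)
        = ∑ p ∈ (Finset.Ioc 0 M).filter Nat.Prime, ∑ m ∈ Finset.Ioc 0 M with p ∣ m, Real.log p := by
          apply Finset.sum_congr rfl
          intro p _
          rw [Finset.sum_const, Nat.Ioc_filter_dvd_card_eq_div, nsmul_eq_mul, mul_comm]
      _ = ∑ m ∈ Finset.Ioc 0 M, ∑ p ∈ m.primeFactors, Real.log p := by
          apply Finset.sum_comm'
          intro p m
          simp only [Finset.mem_filter, Finset.mem_Ioc, Nat.mem_primeFactors]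
          constructor
          · rintro ⟨⟨a, b⟩, c, d⟩; exact ⟨⟨b, d, by omega⟩, c⟩
          · rintro ⟨⟨a, b, c⟩, d⟩; exact ⟨⟨⟨a.pos, (Nat.le_of_dvd d.1 b).trans d.2⟩, a⟩, d, b⟩
      _ ≤ ∑ m ∈ Finset.Ioc 0 M, Real.log M := by
          apply Finset.sum_le_sum
          intro m hm
          rw [Finset.mem_Ioc] at hm
          have := ell_eq_log (S := m.primeFactors) (fun p hp => Nat.prime_of_mem_primeFactors hp)
          unfold ell at this
          rw [this]
          apply Real.log_le_log
          · exact_mod_cast Nat.pos_of_ne_zero (prod_ne_zero_of_prime (fun p hp => Nat.prime_of_mem_primeFactors hp))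
          · exact_mod_cast (Nat.le_of_dvd hm.1 (Nat.prod_primeFactors_dvd m)).trans hm.2
      _ = _ := by simp
  have h3 : ∑ p ∈ (Finset.Ioc 0 M).filter Nat.Prime, Real.log p ≤ Real.log 4 * M := by
    have := Chebyshev.theta_le_log4_mul_x (x := (M:ℝ)) hM0.le
    simpa [Chebyshev.theta] using this
  have h4 : (M:ℝ) * ∑ p ∈ (Finset.Ioc 0 M).filter Nat.Prime, Real.log p * (p:ℝ)⁻¹ ≤
      ∑ p ∈ (Finset.Ioc 0 M).filter Nat.Prime, Real.log p * ((M / p : ℕ) : ℝ) +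
      ∑ p ∈ (Finset.Ioc 0 M).filter Nat.Prime, Real.log p := by
    rw [Finset.mul_sum, ← Finset.sum_add_distrib]
    apply Finset.sum_le_sum
    intro p hp
    have : (M:ℝ) * (p:ℝ)⁻¹ ≤ ((M / p : ℕ) : ℝ) + 1 := by
      rw [← div_eq_mul_inv]
      have := (Nat.lt_floor_add_one ((M:ℝ) / p)).le
      rwa [Nat.floor_div_eq_div] at this
    nlinarith [mul_le_mul_of_nonneg_left this (Real.log_natCast_nonneg p)]
  have h5 : (M:ℝ) * ∑ p ∈ (Finset.Ioc 0 M).filter Nat.Prime, Real.log p * (p:ℝ)⁻¹ ≤ M * (u + Real.log 4) := by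
    nlinarith
  exact le_of_mul_le_mul_left h5 hM0

end GPY

open Real Filter

namespace GPY

noncomputable def xx (L : ℝ) (S : Finset ℕ) : ℝ := max (L - ell S) 0

lemma xx_nonneg (L : ℝ) (S : Finset ℕ) : 0 ≤ xx L S := le_max_right _ _

lemma xx_le {L : ℝ} (hL : 0 ≤ L) (S : Finset ℕ) : xx L S ≤ L := 
  max_le (by linarith [ell_nonneg S]) hL

lemma xx_union {L : ℝ} {S T : Finset ℕ} (h : Disjoint S T) :
    xx L (S ∪ T) = max (xx L S - ell T) 0 := by
  unfold xx
  rw [ell_union h]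
  have := ell_nonneg T
  rcases le_total (L - ell S) 0 with h1 | h1
  · rw [max_eq_right h1, max_eq_right (by linarith), max_eq_right (by linarith)]
  · rw [max_eq_left h1, sub_sub]

noncomputable def TT (P : Finset ℕ) (a : ℕ → ℝ) (L : ℝ) (j : ℕ) : ℝ :=
  ∑ S ∈ P.powerset, (∏ p ∈ S, a p) * (xx L S) ^ j

lemma TT_nonneg (P : Finset ℕ) (a : ℕ → ℝ) (ha : ∀ p ∈ P, 0 ≤ a p) (L : ℝ) (j : ℕ) :
    0 ≤ TT P a L j :=
  Finset.sum_nonneg fun S hS => mul_nonneg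
    (Finset.prod_nonneg fun p hp => ha p (Finset.mem_powerset.1 hS hp)) (pow_nonneg (xx_nonneg _ _) _)

lemma TT_lower (P : Finset ℕ) (a : ℕ → ℝ) (ha : ∀ p ∈ P, 0 ≤ a p) (L : ℝ) (hL : 0 ≤ L) (j : ℕ) :
    L ^ j ≤ TT P a L j := by
  have := Finset.single_le_sum (f := fun S => (∏ p ∈ S, a p) * (xx L S) ^ j) (s := P.powerset)
    (fun S hS => mul_nonneg
    (Finset.prod_nonneg fun p hp => ha p (Finset.mem_powerset.1 hS hp)) (pow_nonneg (xx_nonneg _ _) _))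
    (Finset.empty_mem_powerset P)
  simpa [TT, xx, ell, hL] using this

lemma T_rec (P : Finset ℕ) (a : ℕ → ℝ) (ha : ∀ p ∈ P, 0 ≤ a p) (A β : ℝ)
    (hM : ∀ u, 0 ≤ u → ∑ p ∈ P with Real.log (p:ℕ) ≤ u, a p * Real.log p ≤ A * u + β)
    (L : ℝ) (j : ℕ) (hj : 1 ≤ j) :
    (L - β) * TT P a L j ≤ (1 + A / (j + 1)) * TT P a L (j + 1) := by
  have hprod : ∀ S ∈ P.powerset, 0 ≤ ∏ p ∈ S, a p := fun S hS =>
    Finset.prod_nonneg fun p hp => ha p (Finset.mem_powerset.1 hS hp)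
  have h1 : L * TT P a L j - TT P a L (j + 1) =
      ∑ S ∈ P.powerset, ∑ p ∈ S, (∏ p ∈ S, a p) * (xx L S) ^ j * Real.log p := by
    unfold TT
    rw [Finset.mul_sum, ← Finset.sum_sub_distrib]
    apply Finset.sum_congr rfl
    intro S _
    rw [← Finset.mul_sum]
    change _ = _ * ell S
    unfold xx
    rcases le_total (L - ell S) 0 with h | h
    · rw [max_eq_right h, zero_pow (by omega), zero_pow (by omega)]; ring
    · rw [max_eq_left h]; ring
  have h2 : ∑ S ∈ P.powerset, ∑ p ∈ S, (∏ p ∈ S, a p) * (xx L S) ^ j * Real.log p =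
      ∑ p ∈ P, ∑ S ∈ P.powerset with {p} ⊆ S, (∏ p ∈ S, a p) * (xx L S) ^ j * Real.log p := by
    apply Finset.sum_comm'
    intro S p
    simp only [Finset.mem_powerset, Finset.mem_filter, Finset.singleton_subset_iff]
    constructor
    · rintro ⟨h1, h2⟩; exact ⟨⟨h1, h2⟩, h1 h2⟩
    · rintro ⟨⟨h1, h2⟩, h3⟩; exact ⟨h1, h2⟩
  have h3 : ∑ p ∈ P, ∑ S ∈ P.powerset with {p} ⊆ S, (∏ p ∈ S, a p) * (xx L S) ^ j * Real.log p ≤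
      ∑ p ∈ P, ∑ V ∈ P.powerset, (∏ p ∈ V, a p) * ((a p * Real.log p) * (max (xx L V - Real.log p) 0) ^ j) := by
    apply Finset.sum_le_sum
    intro p hp
    rw [sum_superset P {p} (by simpa using hp)]
    have hsub : (P \ {p}).powerset ⊆ P.powerset := Finset.powerset_mono.2 Finset.sdiff_subset
    refine (Finset.sum_le_sum ?_).trans (Finset.sum_le_sum_of_subset_of_nonneg hsub ?_)
    · intro V hV
      have hd := disj_of_sub hV
      rw [Finset.prod_union hd, Finset.union_comm, xx_union hd.symm]
      simp only [Finset.prod_singleton, ell, Finset.sum_singleton]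
      apply le_of_eq; ring
    · intro V hV _
      have := Real.log_natCast_nonneg p
      have := ha p hp
      have := hprod V hV
      positivity
  have h4 : ∑ p ∈ P, ∑ V ∈ P.powerset, (∏ p ∈ V, a p) * ((a p * Real.log p) * (max (xx L V - Real.log p) 0) ^ j) ≤
      ∑ V ∈ P.powerset, (∏ p ∈ V, a p) * (A * (xx L V) ^ (j + 1) / (j + 1) + β * (xx L V) ^ j) := by
    rw [Finset.sum_comm]
    apply Finset.sum_le_sum
    intro V hV
    rw [← Finset.mul_sum]
    apply mul_le_mul_of_nonneg_left _ (hprod V hV)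
    exact ps_upper P (fun p => a p * Real.log p) (fun p => Real.log p) (fun p _ => Real.log_natCast_nonneg p)
      (xx L V) (xx_nonneg _ _) j hj A β (fun u hu _ => hM u hu)
  have h5 : ∑ V ∈ P.powerset, (∏ p ∈ V, a p) * (A * (xx L V) ^ (j + 1) / (j + 1) + β * (xx L V) ^ j) =
      A / (j + 1) * TT P a L (j + 1) + β * TT P a L j := by
    unfold TT
    rw [Finset.mul_sum, Finset.mul_sum, ← Finset.sum_add_distrib]
    apply Finset.sum_congr rfl
    intro S _
    ring
  rw [h2] at h1
  nlinarith

lemma T_conv (P : Finset ℕ) (a b : ℕ → ℝ) (ha : ∀ p ∈ P, 0 ≤ a p) (hb : ∀ p ∈ P, 0 ≤ b p) (α β : ℝ)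
    (hU : ∀ u, 0 ≤ u → ∑ V ∈ P.powerset with ell V ≤ u, ∏ p ∈ V, b p ≤ α * u + β)
    (L : ℝ) (j : ℕ) (hj : 1 ≤ j) :
    TT P (fun p => a p + b p) L j ≤ α / (j + 1) * TT P a L (j + 1) + β * TT P a L j := by
  refine (conv_le P a b ha hb (fun S => (xx L S) ^ j) (fun A B => (max (xx L A - ell B) 0) ^ j)
    (fun _ _ _ _ => by positivity) (fun S _ T _ hd => by rw [xx_union hd])).trans ?_
  have h5 : ∑ V ∈ P.powerset, (∏ p ∈ V, a p) * (α * (xx L V) ^ (j + 1) / (j + 1) + β * (xx L V) ^ j) =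
      α / (j + 1) * TT P a L (j + 1) + β * TT P a L j := by
    unfold TT
    rw [Finset.mul_sum, Finset.mul_sum, ← Finset.sum_add_distrib]
    apply Finset.sum_congr rfl
    intro S _
    ring
  rw [← h5]
  apply Finset.sum_le_sum
  intro V hV
  apply mul_le_mul_of_nonneg_left _ (Finset.prod_nonneg fun p hp => ha p (Finset.mem_powerset.1 hV hp))
  exact ps_upper P.powerset (fun B => ∏ p ∈ B, b p) ell (fun B _ => ell_nonneg B)
      (xx L V) (xx_nonneg _ _) j hj α β (fun u hu _ => hU u hu)

noncomputable def lam (k : ℕ) (P : Finset ℕ) (L : ℝ) (l : ℕ) (S : Finset ℕ) : ℝ :=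
  (∏ p ∈ S, (-((p:ℝ) / k))) * ∑ T ∈ P.powerset with S ⊆ T, (xx L T) ^ l * ∏ p ∈ T, ((k:ℝ) / (p - k))

lemma Q1_eq (k : ℕ) (hk : 1 ≤ k) (P : Finset ℕ) (hP : ∀ p ∈ P, k < p) (L : ℝ) (l : ℕ) :
    ∑ S ∈ P.powerset, ∑ T ∈ P.powerset, lam k P L l S * lam k P L l T * ∏ p ∈ S ∪ T, ((p:ℝ) / k)⁻¹ =
    TT P (fun p => (k:ℝ) / (p - k)) L (2 * l) := by
  have hk0 : (0:ℝ) < k := by exact_mod_cast hk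
  have hp0 : ∀ p ∈ P, (0:ℝ) < p - k := fun p hp => by
    have : (k:ℝ) < p := by exact_mod_cast hP p hp
    linarith
  have hp1 : ∀ p ∈ P, (0:ℝ) < p := fun p hp => by linarith [hp0 p hp]
  rw [diag P (fun p => (p:ℝ) / k) (lam k P L l) (fun p hp => by have := hp1 p hp; positivity)]
  apply Finset.sum_congr rfl
  intro U hU
  have hU' := Finset.mem_powerset.1 hU
  have := lam_sum P (fun T => (xx L T) ^ l) (fun p => (p:ℝ) / k) (fun p => (k:ℝ) / (p - k))
    (fun p => ((p:ℝ) / k)⁻¹) U hU'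
  unfold lam
  rw [this]
  have hV : ∑ V ∈ (P \ U).powerset, xx L (U ∪ V) ^ l *
      ∏ p ∈ V, ((1 - (p:ℝ) / k * ((p:ℝ) / k)⁻¹) * ((k:ℝ) / (p - k))) = xx L U ^ l := by
    rw [Finset.sum_eq_single ∅]
    · simp
    · intro V hV hne
      obtain ⟨p, hp⟩ := Finset.nonempty_iff_ne_empty.2 hne
      have hpP : p ∈ P := (Finset.mem_sdiff.1 (Finset.mem_powerset.1 hV hp)).1
      rw [Finset.prod_eq_zero hp, mul_zero]
      rw [mul_inv_cancel₀ (by have := hp1 p hpP; positivity)]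
      ring
    · intro h; exact absurd (Finset.empty_mem_powerset _) h
  rw [hV, mul_pow, ← mul_assoc, ← Finset.prod_pow, ← Finset.prod_mul_distrib, ← pow_mul, mul_comm l 2]
  congr 1
  apply Finset.prod_congr rfl
  intro p hp
  have h1 := hp0 p (hU' hp)
  have h2 := hp1 p (hU' hp)
  field_simp

lemma Q2_inner (P Q : Finset ℕ) (hP : ∀ p ∈ P, p.Prime) (hQ : ∀ p ∈ Q, p.Prime) (hd : Disjoint Q P)
    (L : ℝ) (hc : ∀ p : ℕ, p.Prime → (p:ℝ) ≤ Real.exp L → p ∈ Q ∪ P) (l : ℕ) (hl : 1 ≤ l)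
    (U : Finset ℕ) (hU : U ⊆ P) :
    (∏ p ∈ Q, (1 - (p:ℝ)⁻¹)) * (∏ p ∈ U, (1 - (p:ℝ)⁻¹)) * (xx L U) ^ (l + 1) / (l + 1) ≤
    ∑ V ∈ (P \ U).powerset, xx L (U ∪ V) ^ l * ∏ p ∈ V, ((p:ℝ) - 1)⁻¹ := by
  have hdU : Disjoint Q U := hd.mono_right hU
  rw [← Finset.prod_union hdU]
  refine (ps_lower (P \ U).powerset (fun V => ∏ p ∈ V, ((p:ℝ) - 1)⁻¹) ell (fun V _ => ell_nonneg V)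
    (xx L U) (xx_nonneg _ _) l hl _ ?_).trans (le_of_eq ?_)
  · intro u hu huL
    apply euler_lower (Q ∪ U) (P \ U) (fun p hp => (Finset.mem_union.1 hp).elim (hQ p) (fun h => hP p (hU h)))
      (fun p hp => hP p (Finset.mem_sdiff.1 hp).1)
    · rw [Finset.disjoint_union_left]
      exact ⟨hd.mono_right Finset.sdiff_subset, Finset.disjoint_sdiff⟩
    · intro p hp hpu
      by_cases hL : 0 ≤ L
      · have := hc p hp (hpu.trans (Real.exp_le_exp.2 (huL.trans (xx_le hL U))))
        simp only [Finset.mem_union, Finset.mem_sdiff] at *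
        tauto
      · have h0 : xx L U = 0 := by
          unfold xx; exact max_eq_right (by linarith [ell_nonneg U])
        have : u = 0 := by linarith
        rw [this, Real.exp_zero] at hpu
        have : p ≤ 1 := by exact_mod_cast hpu
        exact absurd hp.one_lt (by omega)
  · apply Finset.sum_congr rfl
    intro V hV
    rw [xx_union (disj_of_sub hV), mul_comm]

lemma Q2_lower (k : ℕ) (hk : 2 ≤ k) (P Q : Finset ℕ) (hPk : ∀ p ∈ P, k < p)
    (hP : ∀ p ∈ P, p.Prime) (hQ : ∀ p ∈ Q, p.Prime) (hd : Disjoint Q P)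
    (L : ℝ) (hc : ∀ p : ℕ, p.Prime → (p:ℝ) ≤ Real.exp L → p ∈ Q ∪ P) (l : ℕ) (hl : 1 ≤ l) :
    (∏ p ∈ Q, (1 - (p:ℝ)⁻¹)) ^ 2 / (l + 1) ^ 2 * TT P (fun p => ((k:ℝ) - 1) / (p - k)) L (2 * l + 2) ≤
    ∑ S ∈ P.powerset, ∑ T ∈ P.powerset, lam k P L l S * lam k P L l T *
      ∏ p ∈ S ∪ T, (((p:ℝ) - 1) / (k - 1))⁻¹ := by
  have hk0 : (2:ℝ) ≤ k := by exact_mod_cast hk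
  have hk1 : (0:ℝ) < k - 1 := by linarith
  have hp0 : ∀ p ∈ P, (0:ℝ) < p - k := fun p hp => by
    have : (k:ℝ) < p := by exact_mod_cast hPk p hp
    linarith
  have hp1 : ∀ p ∈ P, (0:ℝ) < p - 1 := fun p hp => by linarith [hp0 p hp]
  rw [diag P (fun p => ((p:ℝ) - 1) / (k - 1)) (lam k P L l) (fun p hp => by have := hp1 p hp; positivity)]
  unfold TT
  rw [Finset.mul_sum]
  apply Finset.sum_le_sum
  intro U hU
  have hU' := Finset.mem_powerset.1 hU
  have := lam_sum P (fun T => (xx L T) ^ l) (fun p => (p:ℝ) / k) (fun p => (k:ℝ) / (p - k))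
    (fun p => (((p:ℝ) - 1) / (k - 1))⁻¹) U hU'
  unfold lam
  rw [this]
  have hV : ∑ V ∈ (P \ U).powerset, xx L (U ∪ V) ^ l *
      ∏ p ∈ V, ((1 - (p:ℝ) / k * (((p:ℝ) - 1) / (k - 1))⁻¹) * ((k:ℝ) / (p - k))) =
      ∑ V ∈ (P \ U).powerset, xx L (U ∪ V) ^ l * ∏ p ∈ V, ((p:ℝ) - 1)⁻¹ := by
    apply Finset.sum_congr rfl
    intro V hV
    congr 1
    apply Finset.prod_congr rfl
    intro p hp
    have hpP : p ∈ P := (Finset.mem_sdiff.1 (Finset.mem_powerset.1 hV hp)).1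
    have h1 := hp0 p hpP
    have h2 := hp1 p hpP
    field_simp
    ring
  rw [hV]
  conv_rhs => rw [mul_pow, ← mul_assoc, ← Finset.prod_pow, ← Finset.prod_mul_distrib]
  have hin := Q2_inner P Q hP hQ hd L hc l hl U hU'
  have hΦ : 0 < ∏ p ∈ Q, (1 - (p:ℝ)⁻¹) := Finset.prod_pos fun p hp => one_sub_inv_pos (hQ p hp)
  have hΦU : 0 < ∏ p ∈ U, (1 - (p:ℝ)⁻¹) := Finset.prod_pos fun p hp => one_sub_inv_pos (hP p (hU' hp))
  have hx := xx_nonneg L U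
  have hsq := pow_le_pow_left₀ (by positivity) hin 2
  have hpos : 0 ≤ ∏ i ∈ U, (((i:ℝ) - 1) / (k - 1) - 1) *
      (-((i:ℝ) / k) * (((i:ℝ) - 1) / (k - 1))⁻¹ * (k / (i - k))) ^ 2 := by
    apply Finset.prod_nonneg
    intro p hp
    have h1 := hp0 p (hU' hp)
    apply mul_nonneg _ (sq_nonneg _)
    rw [sub_nonneg, le_div_iff₀ hk1]; linarith
  refine le_trans (le_of_eq ?_) (mul_le_mul_of_nonneg_left hsq hpos)
  have e : (∏ i ∈ U, (((i:ℝ) - 1) / (k - 1) - 1) *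
      (-((i:ℝ) / k) * (((i:ℝ) - 1) / (k - 1))⁻¹ * (k / (i - k))) ^ 2) * (∏ p ∈ U, (1 - (p:ℝ)⁻¹)) ^ 2 =
      ∏ p ∈ U, ((k:ℝ) - 1) / (p - k) := by
    rw [← Finset.prod_pow, ← Finset.prod_mul_distrib]
    apply Finset.prod_congr rfl
    intro p hp
    have h1 := hp0 p (hU' hp)
    have h2 := hp1 p (hU' hp)
    have h3 : (0:ℝ) < p := by linarith
    field_simp
    ring
  rw [← e]
  generalize (∏ i ∈ U, (((i:ℝ) - 1) / (k - 1) - 1) *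
      (-((i:ℝ) / k) * (((i:ℝ) - 1) / (k - 1))⁻¹ * (k / (i - k))) ^ 2) = X1
  generalize ∏ p ∈ U, (1 - (p:ℝ)⁻¹) = X2
  generalize ∏ p ∈ Q, (1 - (p:ℝ)⁻¹) = X3
  have hl1 : (l:ℝ) + 1 ≠ 0 := by positivity
  field_simp
  ring

lemma M_bound (P : Finset ℕ) (hP : ∀ p ∈ P, p.Prime) (u : ℝ) (hu : 0 ≤ u) (m : ℕ) :
    ∑ V ∈ P.powerset with ell V ≤ u, ∏ p ∈ V, ((m:ℝ) * (p:ℝ)⁻¹) ≤ (1 + u) ^ m := by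
  induction m with
  | zero =>
    rw [Finset.sum_eq_single ∅]
    · simp
    · intro V hV hne
      obtain ⟨p, hp⟩ := Finset.nonempty_iff_ne_empty.2 hne
      exact Finset.prod_eq_zero hp (by simp)
    · intro h
      exfalso; apply h
      rw [Finset.mem_filter]; exact ⟨Finset.empty_mem_powerset _, by simpa [ell] using hu⟩
  | succ m ih =>
    have e : ∀ V ∈ P.powerset, (if ell V ≤ u then ∏ p ∈ V, (((m + 1 : ℕ):ℝ) * (p:ℝ)⁻¹) else 0) =
        (∏ p ∈ V, ((m:ℝ) * (p:ℝ)⁻¹ + (p:ℝ)⁻¹)) * (if ell V ≤ u then 1 else 0) := by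
      intro V hV
      split_ifs
      · rw [mul_one]
        apply Finset.prod_congr rfl
        intro p hp
        push_cast; ring
      · simp
    rw [Finset.sum_filter, Finset.sum_congr rfl e]
    refine (conv_le P _ _ (fun p _ => by positivity) (fun p hp => by positivity) _
      (fun S T => (if ell S ≤ u then 1 else 0) * if ell T ≤ u then 1 else 0) 
      (fun S _ T _ => by split_ifs <;> norm_num) ?_).trans ?_
    · intro S _ T _ hd
      have h1 := ell_nonneg S
      have h2 := ell_nonneg T
      rw [ell_union hd]
      by_cases h : ell S + ell T ≤ u
      · rw [if_pos h, if_pos (by linarith), if_pos (by linarith)]; norm_num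
      · rw [if_neg h]; split_ifs <;> norm_num
    · have h2 : ∑ B ∈ P.powerset, (∏ p ∈ B, (p:ℝ)⁻¹) * (if ell B ≤ u then 1 else 0) ≤ 1 + u := by
        simp only [mul_ite, mul_one, mul_zero]
        rw [← Finset.sum_filter]
        have := sqfree_le P hP 1 (by simp) u
        simp only [Nat.coprime_one_left_eq_true, Finset.filter_true] at this
        exact this.trans (harm_upper u hu)
      have h3 : ∀ A ∈ P.powerset, (∏ p ∈ A, ((m:ℝ) * (p:ℝ)⁻¹)) * ∑ B ∈ P.powerset, (∏ p ∈ B, (p:ℝ)⁻¹) *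
          ((if ell A ≤ u then 1 else 0) * if ell B ≤ u then 1 else 0) =
          (if ell A ≤ u then (∏ p ∈ A, ((m:ℝ) * (p:ℝ)⁻¹)) else 0) * 
            ∑ B ∈ P.powerset, (∏ p ∈ B, (p:ℝ)⁻¹) * (if ell B ≤ u then 1 else 0) := by
        intro A _
        split_ifs
        · simp
        · simp
      rw [Finset.sum_congr rfl h3, ← Finset.sum_mul, ← Finset.sum_filter, pow_succ]
      exact mul_le_mul ih h2 (Finset.sum_nonneg fun B _ => mul_nonneg (Finset.prod_nonneg fun p _ => by positivity) (by split_ifs <;> norm_num)) (by positivity)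

lemma lam_bound (k : ℕ) (hk : 1 ≤ k) (P : Finset ℕ) (hP : ∀ p ∈ P, p.Prime) (hPk : ∀ p ∈ P, 2 * k < p)
    (L : ℝ) (hL : 0 ≤ L) (l : ℕ) (hl : 1 ≤ l) (S : Finset ℕ) (hS : S ⊆ P) :
    |lam k P L l S| ≤ if ell S ≤ L then 2 ^ S.card * (L ^ l * (1 + L) ^ (2 * k)) else 0 := by
  have hk0 : (0:ℝ) < k := by exact_mod_cast hk
  have hpk : ∀ p ∈ P, (p:ℝ) / 2 ≤ (p:ℝ) - k ∧ (0:ℝ) < p := by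
    intro p hp
    have h1 : (2:ℝ) * k < p := by exact_mod_cast hPk p hp
    constructor <;> linarith
  have hkp : ∀ p ∈ P, 0 ≤ (k:ℝ) / (p - k) := fun p hp => by
    obtain ⟨h1, h2⟩ := hpk p hp
    have : (0:ℝ) < p - k := by linarith
    positivity
  unfold lam
  rw [sum_superset P S hS]
  split_ifs with h
  · have h1 : ∑ V ∈ (P \ S).powerset, xx L (S ∪ V) ^ l * ∏ p ∈ S ∪ V, ((k:ℝ) / (p - k)) =
      (∏ p ∈ S, ((k:ℝ) / (p - k))) * ∑ V ∈ (P \ S).powerset, xx L (S ∪ V) ^ l * ∏ p ∈ V, ((k:ℝ) / (p - k)) := by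
      rw [Finset.mul_sum]
      apply Finset.sum_congr rfl
      intro V hV
      rw [Finset.prod_union (disj_of_sub hV)]
      ring
    rw [h1, ← mul_assoc, ← Finset.prod_mul_distrib, abs_mul, Finset.abs_prod]
    apply mul_le_mul _ _ (abs_nonneg _) (by positivity)
    · rw [← Finset.prod_const]
      apply Finset.prod_le_prod (fun _ _ => abs_nonneg _)
      intro p hp
      obtain ⟨h1, h2⟩ := hpk p (hS hp)
      have h3 : (0:ℝ) < p - k := by linarith
      have : -((p:ℝ) / k) * ((k:ℝ) / (p - k)) = -(p / (p - k)) := by field_simp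
      rw [this, abs_neg, abs_of_pos (by positivity), div_le_iff₀ h3]
      linarith
    · rw [abs_of_nonneg (Finset.sum_nonneg fun V hV => mul_nonneg (pow_nonneg (xx_nonneg _ _) _)
        (Finset.prod_nonneg fun p hp => hkp p (Finset.mem_sdiff.1 (Finset.mem_powerset.1 hV hp)).1))]
      have h2 := M_bound P hP L hL (2 * k)
      have hsub : (P \ S).powerset ⊆ P.powerset := Finset.powerset_mono.2 Finset.sdiff_subset
      refine le_trans ?_ (mul_le_mul_of_nonneg_left h2 (by positivity : 0 ≤ L ^ l))
      rw [Finset.sum_filter, Finset.mul_sum]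
      refine (Finset.sum_le_sum ?_).trans (Finset.sum_le_sum_of_subset_of_nonneg hsub ?_)
      · intro V hV
        split_ifs with hVL
        · apply mul_le_mul (pow_le_pow_left₀ (xx_nonneg _ _) (xx_le hL _) l) _
            (Finset.prod_nonneg fun p hp => hkp p (Finset.mem_sdiff.1 (Finset.mem_powerset.1 hV hp)).1) (by positivity)
          apply Finset.prod_le_prod (fun p hp => hkp p (Finset.mem_sdiff.1 (Finset.mem_powerset.1 hV hp)).1)
          intro p hp
          obtain ⟨h1, h2⟩ := hpk p (Finset.mem_sdiff.1 (Finset.mem_powerset.1 hV hp)).1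
          have h3 : (0:ℝ) < p - k := by linarith
          push_cast
          rw [div_le_iff₀ h3]
          field_simp
          linarith
        · have : xx L (S ∪ V) = 0 := by
            unfold xx
            rw [ell_union (disj_of_sub hV)]
            exact max_eq_right (by linarith [ell_nonneg S])
          rw [this, zero_pow (by omega)]; simp
      · intro V _ _
        split_ifs
        · exact mul_nonneg (by positivity) (Finset.prod_nonneg fun p _ => by positivity)
        · simp
  · rw [Finset.sum_eq_zero]
    · simp
    · intro V hV
      have : xx L (S ∪ V) = 0 := by
        unfold xx
        rw [ell_union (disj_of_sub hV)]
        exact max_eq_right (by linarith [ell_nonneg V])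
      rw [this, zero_pow (by omega)]; simp

end GPY

open Real Filter

namespace GPY

set_option maxHeartbeats 1000000 in
lemma compare (k l D W : ℕ) (hk : 2 ≤ k) (hl : 1 ≤ l) (δ : ℝ) (hδ : 0 < δ) (hW : 0 < W)
    (hD : 2 * k ≤ D) (hDe : Real.exp (2 * k / D) ≤ 1 + δ) (hDδ : k * (1 + δ) ≤ δ * D) :
    ∃ L0 : ℝ, 1 ≤ L0 ∧ ∀ L ≥ L0, ∀ P : Finset ℕ, (∀ p ∈ P, p.Prime) → (∀ p ∈ P, D < p) →
      (∀ p ∈ P, W.Coprime p) →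
      (2 * l + 1) * (2 * l + 2) * L * TT P (fun p => (k:ℝ) / (p - k)) L (2 * l) ≤
        (1 + δ) ^ 4 * ((W.totient : ℝ) / W) * (k + 2 * l + 1) *
          TT P (fun p => ((k:ℝ) - 1) / (p - k)) L (2 * l + 2) := by
  have hk0 : (2:ℝ) ≤ k := by exact_mod_cast hk
  have hl0 : (1:ℝ) ≤ l := by exact_mod_cast hl
  have hW0 : (0:ℝ) < W := by exact_mod_cast hW
  set Φ : ℝ := (W.totient : ℝ) / W with hΦd
  have hΦ : 0 < Φ := by
    have : (0:ℝ) < W.totient := by exact_mod_cast Nat.totient_pos.2 hW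
    positivity
  set A : ℝ := (1 + δ) * (k - 1) with hA
  have hA0 : 0 < A := by apply mul_pos <;> linarith
  set β' : ℝ := A * Real.log 4 with hβ'
  set α : ℝ := (1 + δ) * Φ with hα
  have hα0 : 0 < α := by positivity
  set β : ℝ := (1 + δ) * (W + 1) with hβ
  have hβ0 : 0 < β := by positivity
  set K := β * (1 + δ) * (1 + A / (2 * l + 1)) * (2 * l + 1) with hK
  have hK0 : 0 < K := by positivity
  refine ⟨max 1 (max (β' * (1 + δ) / δ) (K / (δ * α))), le_max_left _ _, ?_⟩
  intro L hL P hP hPD hPW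
  have hL1 : 1 ≤ L := (le_max_left _ _).trans hL
  have hL2 : β' * (1 + δ) ≤ δ * L := by
    have : β' * (1 + δ) / δ ≤ L := ((le_max_left _ _).trans (le_max_right _ _)).trans hL
    rw [div_le_iff₀ hδ] at this; linarith
  have hL3 : K ≤ δ * α * L := by
    have : K / (δ * α) ≤ L := ((le_max_right _ _).trans (le_max_right _ _)).trans hL
    rw [div_le_iff₀ (by positivity)] at this; linarith
  have hpD : ∀ p ∈ P, (D:ℝ) < p := fun p hp => by exact_mod_cast hPD p hp
  have hDk : (2:ℝ) * k ≤ D := by exact_mod_cast hD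
  have hpk : ∀ p ∈ P, (0:ℝ) < (p:ℝ) - k := fun p hp => by linarith [hpD p hp]
  have ha : ∀ p ∈ P, 0 ≤ ((k:ℝ) - 1) / (p - k) := fun p hp =>
    div_nonneg (by linarith) (hpk p hp).le
  have hb : ∀ p ∈ P, 0 ≤ ((p:ℝ) - k)⁻¹ := fun p hp => (inv_pos.2 (hpk p hp)).le
  have hM : ∀ u, 0 ≤ u → ∑ p ∈ P with Real.log (p:ℕ) ≤ u, ((k:ℝ) - 1) / (p - k) * Real.log p ≤ A * u + β' := by
    intro u hu
    have h1 := mertens_upper P hP u hu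
    have h2 : A * u + β' = A * (u + Real.log 4) := by rw [hβ']; ring
    rw [h2]
    refine le_trans ?_ (mul_le_mul_of_nonneg_left h1 hA0.le)
    rw [Finset.mul_sum]
    apply Finset.sum_le_sum
    intro p hp
    have hp' := (Finset.mem_filter.1 hp).1
    have h3 := hpk p hp'
    have h4 := hpD p hp'
    have h5 : (0:ℝ) < p := by linarith
    have h6 : ((k:ℝ) - 1) / (p - k) ≤ A * (p:ℝ)⁻¹ := by
      rw [div_le_iff₀ h3, hA]
      field_simp
      have h7 : (p:ℝ) ≤ (1 + δ) * (p - k) := by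
        have := mul_lt_mul_of_pos_left h4 hδ
        linarith
      have := mul_le_mul_of_nonneg_left h7 (by linarith : 0 ≤ (k:ℝ) - 1)
      linarith
    calc _ ≤ A * (p:ℝ)⁻¹ * Real.log p := mul_le_mul_of_nonneg_right h6 (Real.log_natCast_nonneg p)
      _ = _ := by ring
  have hU : ∀ u, 0 ≤ u → ∑ V ∈ P.powerset with ell V ≤ u, ∏ p ∈ V, ((p:ℝ) - k)⁻¹ ≤ α * u + β := by
    intro u hu
    refine (upper_U1 k D W hW (by omega) hD P hP hPD hPW u hu).trans ?_
    have : α * u + β = (1 + δ) * (Φ * u + (W + 1)) := by rw [hα, hβ]; ring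
    rw [this]
    exact mul_le_mul_of_nonneg_right hDe (by positivity)
  have c1 := T_conv P _ _ ha hb α β hU L (2 * l) (by omega)
  have c2 := T_rec P _ ha A β' hM L (2 * l) (by omega)
  have c3 := T_rec P _ ha A β' hM L (2 * l + 1) (by omega)
  have t0 := TT_nonneg P _ ha L (2 * l)
  have t1 := TT_nonneg P _ ha L (2 * l + 1)
  have t2 := TT_nonneg P _ ha L (2 * l + 2)
  have e0 : (fun p : ℕ => ((k:ℝ) - 1) / (p - k) + ((p:ℝ) - k)⁻¹) = fun p : ℕ => (k:ℝ) / (p - k) := by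
    funext p
    rw [div_eq_mul_inv, div_eq_mul_inv]; ring
  rw [e0] at c1
  push_cast at c1 c2 c3
  rw [show 2 * l + 1 + 1 = 2 * l + 2 by ring] at c3
  generalize TT P (fun p => ((k:ℝ) - 1) / (p - k)) L (2 * l + 2) = T2 at *
  generalize TT P (fun p => ((k:ℝ) - 1) / (p - k)) L (2 * l + 1) = T1 at *
  generalize TT P (fun p => ((k:ℝ) - 1) / (p - k)) L (2 * l) = T0 at *
  generalize TT P (fun p => (k:ℝ) / (p - k)) L (2 * l) = X at *
  have hLb : L ≤ (1 + δ) * (L - β') := by linarith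
  have d2 : L * T0 ≤ (1 + δ) * ((1 + A / (2 * l + 1)) * T1) := by
    calc L * T0 ≤ (1 + δ) * (L - β') * T0 := mul_le_mul_of_nonneg_right hLb t0
      _ = (1 + δ) * ((L - β') * T0) := by ring
      _ ≤ _ := mul_le_mul_of_nonneg_left c2 (by linarith)
  have d3 : L * T1 ≤ (1 + δ) * ((1 + A / (2 * l + 1 + 1)) * T2) := by
    calc L * T1 ≤ (1 + δ) * (L - β') * T1 := mul_le_mul_of_nonneg_right hLb t1
      _ = (1 + δ) * ((L - β') * T1) := by ring
      _ ≤ _ := mul_le_mul_of_nonneg_left c3 (by linarith)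
  have d4 : β * T0 * (2 * l + 1) ≤ δ * α * T1 := by
    have : L * (β * T0 * (2 * l + 1)) ≤ L * (δ * α * T1) := by
      calc L * (β * T0 * (2 * l + 1)) = (β * (2 * l + 1)) * (L * T0) := by ring
        _ ≤ (β * (2 * l + 1)) * ((1 + δ) * ((1 + A / (2 * l + 1)) * T1)) :=
          mul_le_mul_of_nonneg_left d2 (by positivity)
        _ = K * T1 := by rw [hK]; ring
        _ ≤ (δ * α * L) * T1 := mul_le_mul_of_nonneg_right hL3 t1
        _ = _ := by ring
    exact le_of_mul_le_mul_left this (by linarith)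
  have d1 : (2 * l + 1) * X ≤ (1 + δ) * α * T1 := by
    calc (2 * l + 1) * X ≤ (2 * l + 1) * (α / (2 * l + 1) * T1 + β * T0) := mul_le_mul_of_nonneg_left c1 (by positivity)
      _ = α * T1 + β * T0 * (2 * l + 1) := by field_simp
      _ ≤ α * T1 + δ * α * T1 := by linarith
      _ = _ := by ring
  have d5 : (2 * l + 2) * (1 + A / (2 * l + 1 + 1)) ≤ (1 + δ) * (k + 2 * l + 1) := by
    have : (2 * (l:ℝ) + 2) * (1 + A / (2 * l + 1 + 1)) = 2 * l + 2 + A := by field_simp; ring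
    rw [this, hA]
    have : 0 ≤ δ * (l:ℝ) := by positivity
    linarith
  calc (2 * l + 1) * (2 * l + 2) * L * X = (2 * l + 2) * L * ((2 * l + 1) * X) := by ring
    _ ≤ (2 * l + 2) * L * ((1 + δ) * α * T1) := mul_le_mul_of_nonneg_left d1 (by positivity)
    _ = (2 * l + 2) * ((1 + δ) * α) * (L * T1) := by ring
    _ ≤ (2 * l + 2) * ((1 + δ) * α) * ((1 + δ) * ((1 + A / (2 * l + 1 + 1)) * T2)) :=
        mul_le_mul_of_nonneg_left d3 (by positivity)
    _ = (1 + δ) ^ 2 * α * T2 * ((2 * l + 2) * (1 + A / (2 * l + 1 + 1))) := by ring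
    _ ≤ (1 + δ) ^ 2 * α * T2 * ((1 + δ) * (k + 2 * l + 1)) := mul_le_mul_of_nonneg_left d5 (by positivity)
    _ = _ := by rw [hα]; ring

end GPY

open Real Filter

namespace GPY

lemma crt_one (W p b a : ℕ) (hp : p.Prime) (hWp : W.Coprime p) :
    ∃ c, ∀ n, n ≡ c [MOD W * p] ↔ (n ≡ b [MOD W] ∧ p ∣ n + a) := by
  obtain ⟨c, hc1, hc2⟩ := Nat.chineseRemainder hWp b (a * (p - 1))
  refine ⟨c, fun n => ?_⟩
  have hpa : ∀ n, p ∣ n + a ↔ n ≡ a * (p - 1) [MOD p] := by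
    intro n
    have h1 : a * (p - 1) + a = a * p := by
      obtain ⟨m, rfl⟩ : ∃ m, p = m + 1 := ⟨p - 1, by have := hp.pos; omega⟩
      simp; ring
    have h2 : (a * (p - 1) + a) ≡ 0 [MOD p] := by
      rw [h1]; exact (Nat.modEq_zero_iff_dvd.2 (Dvd.intro_left a rfl))
    rw [← Nat.modEq_zero_iff_dvd]
    constructor
    · intro h; exact Nat.ModEq.add_right_cancel' a (h.trans h2.symm)
    · intro h; exact (h.add_right a).trans h2
  rw [hpa, ← Nat.modEq_and_modEq_iff_modEq_mul hWp]
  constructor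
  · rintro ⟨h1, h2⟩; exact ⟨h1.trans hc1, h2.trans hc2⟩
  · rintro ⟨h1, h2⟩; exact ⟨h1.trans hc1.symm, h2.trans hc2.symm⟩

lemma uniq_dvd {k : ℕ} (h : Fin k → ℕ) (hinj : Function.Injective h) (p : ℕ) (hp : ∀ i, h i < p)
    (n : ℕ) (i j : Fin k) (hi : p ∣ n + h i) (hj : p ∣ n + h j) : i = j := by
  have : n + h i ≡ n + h j [MOD p] :=
    (Nat.modEq_zero_iff_dvd.2 hi).trans (Nat.modEq_zero_iff_dvd.2 hj).symm
  have := Nat.ModEq.add_left_cancel' n this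
  exact hinj (Nat.ModEq.eq_of_lt_of_lt this (hp i) (hp j))

lemma count {k : ℕ} (h : Fin k → ℕ) (hinj : Function.Injective h) (J : Finset (Fin k))
    (X : Finset ℕ) (g : ℕ → ℝ) (m e : ℝ) (U : Finset ℕ) : ∀ (W b : ℕ),
    (∀ p ∈ U, p.Prime ∧ W.Coprime p ∧ ∀ i, h i < p) → (∀ i ∉ J, Nat.Coprime (b + h i) W) →
    (∀ c, (∀ i ∉ J, Nat.Coprime (c + h i) (W * ∏ p ∈ U, p)) →
      |∑ n ∈ X with n ≡ c [MOD W * ∏ p ∈ U, p], g n - m| ≤ e) →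
    |∑ n ∈ X with n ≡ b [MOD W] ∧ ∀ p ∈ U, ∃ j ∈ J, p ∣ n + h j, g n - (J.card:ℝ) ^ U.card * m| ≤
      (J.card:ℝ) ^ U.card * e := by
  induction U using Finset.induction_on with
  | empty =>
    intro W b _ hb hc
    simpa using hc b (by simpa using hb)
  | insert p U hpU ih =>
    intro W b hU hb hc
    obtain ⟨hp, hWp, hhp⟩ := hU p (Finset.mem_insert_self _ _)
    choose c hcn using fun j : Fin k => crt_one W p b (h j) hp hWp
    have hprod : W * ∏ q ∈ insert p U, q = W * p * ∏ q ∈ U, q := by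
      rw [Finset.prod_insert hpU, mul_assoc]
    rw [hprod] at hc
    have key : ∀ j ∈ J, |∑ n ∈ X with n ≡ c j [MOD W * p] ∧ ∀ q ∈ U, ∃ j ∈ J, q ∣ n + h j, g n -
        (J.card:ℝ) ^ U.card * m| ≤ (J.card:ℝ) ^ U.card * e := by
      intro j hj
      apply ih (W * p) (c j)
      · intro q hq
        obtain ⟨h1, h2, h3⟩ := hU q (Finset.mem_insert_of_mem hq)
        refine ⟨h1, Nat.Coprime.mul_left h2 ?_, h3⟩
        rw [Nat.coprime_primes hp h1]
        rintro rfl; exact hpU hq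
      · intro i hi
        obtain ⟨h1, h2⟩ := (hcn j (c j)).1 rfl
        apply Nat.Coprime.mul_right
        · have := hb i hi
          rw [Nat.Coprime, ← this.gcd_eq_one]
          exact (h1.add_right (h i)).gcd_eq
        · rw [Nat.coprime_comm, hp.coprime_iff_not_dvd]
          intro h3
          have := uniq_dvd h hinj p hhp (c j) i j h3 h2
          exact hi (this ▸ hj)
      · exact hc
    have hsum : ∑ n ∈ X with n ≡ b [MOD W] ∧ ∀ q ∈ insert p U, ∃ j ∈ J, q ∣ n + h j, g n =
        ∑ j ∈ J, ∑ n ∈ X with n ≡ c j [MOD W * p] ∧ ∀ q ∈ U, ∃ j ∈ J, q ∣ n + h j, g n := by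
      simp only [Finset.sum_filter]
      rw [Finset.sum_comm]
      apply Finset.sum_congr rfl
      intro n _
      simp only [hcn]
      by_cases hn : n ≡ b [MOD W] ∧ ∀ q ∈ insert p U, ∃ j ∈ J, q ∣ n + h j
      · rw [if_pos hn]
        obtain ⟨h1, h2⟩ := hn
        obtain ⟨j, hj, hjp⟩ := h2 p (Finset.mem_insert_self _ _)
        rw [Finset.sum_eq_single_of_mem j hj]
        · rw [if_pos ⟨⟨h1, hjp⟩, fun q hq => h2 q (Finset.mem_insert_of_mem hq)⟩]
        · intro i _ hij
          rw [if_neg]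
          rintro ⟨⟨_, h4⟩, _⟩
          exact hij (uniq_dvd h hinj p hhp n i j h4 hjp)
      · rw [if_neg hn, Finset.sum_eq_zero]
        intro j hj
        rw [if_neg]
        rintro ⟨⟨h1, h2⟩, h3⟩
        apply hn
        refine ⟨h1, fun q hq => ?_⟩
        rcases Finset.mem_insert.1 hq with rfl | hq
        · exact ⟨j, hj, h2⟩
        · exact h3 q hq
    rw [hsum, Finset.card_insert_of_notMem hpU]
    have e1 : ∑ j ∈ J, ∑ n ∈ X with n ≡ c j [MOD W * p] ∧ ∀ q ∈ U, ∃ j ∈ J, q ∣ n + h j, g n -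
        (J.card:ℝ) ^ (U.card + 1) * m =
        ∑ j ∈ J, (∑ n ∈ X with n ≡ c j [MOD W * p] ∧ ∀ q ∈ U, ∃ j ∈ J, q ∣ n + h j, g n -
          (J.card:ℝ) ^ U.card * m) := by
      rw [Finset.sum_sub_distrib, Finset.sum_const, nsmul_eq_mul]; ring
    rw [e1]
    refine (Finset.abs_sum_le_sum_abs _ _).trans ((Finset.sum_le_sum key).trans (le_of_eq ?_))
    rw [Finset.sum_const, nsmul_eq_mul]; ring

lemma expand {k : ℕ} (h : Fin k → ℕ) (J : Finset (Fin k)) (P : Finset ℕ)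
    (X : Finset ℕ) (g : ℕ → ℝ) (W b : ℕ) (lm m e : Finset ℕ → ℝ)
    (H : ∀ U ⊆ P, |∑ n ∈ X with n ≡ b [MOD W] ∧ ∀ p ∈ U, ∃ j ∈ J, p ∣ n + h j, g n - m U| ≤ e U) :
    |∑ n ∈ X with n ≡ b [MOD W], g n * (∑ S ∈ P.powerset with ∀ p ∈ S, ∃ j ∈ J, p ∣ n + h j, lm S) ^ 2 -
      ∑ S ∈ P.powerset, ∑ T ∈ P.powerset, lm S * lm T * m (S ∪ T)| ≤
      ∑ S ∈ P.powerset, ∑ T ∈ P.powerset, |lm S| * |lm T| * e (S ∪ T) := by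
  have h1 : ∑ n ∈ X with n ≡ b [MOD W], g n * (∑ S ∈ P.powerset with ∀ p ∈ S, ∃ j ∈ J, p ∣ n + h j, lm S) ^ 2 =
      ∑ S ∈ P.powerset, ∑ T ∈ P.powerset, lm S * lm T *
        ∑ n ∈ X with n ≡ b [MOD W] ∧ ∀ p ∈ S ∪ T, ∃ j ∈ J, p ∣ n + h j, g n := by
    have : ∀ n, g n * (∑ S ∈ P.powerset with ∀ p ∈ S, ∃ j ∈ J, p ∣ n + h j, lm S) ^ 2 =
        ∑ S ∈ P.powerset, ∑ T ∈ P.powerset, lm S * lm T *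
          if ∀ p ∈ S ∪ T, ∃ j ∈ J, p ∣ n + h j then g n else 0 := by
      intro n
      rw [sq, Finset.sum_filter, Finset.sum_mul_sum, Finset.mul_sum]
      apply Finset.sum_congr rfl
      intro S _
      rw [Finset.mul_sum]
      apply Finset.sum_congr rfl
      intro T _
      have : (∀ p ∈ S ∪ T, ∃ j ∈ J, p ∣ n + h j) ↔
          (∀ p ∈ S, ∃ j ∈ J, p ∣ n + h j) ∧ (∀ p ∈ T, ∃ j ∈ J, p ∣ n + h j) := by
        simp only [Finset.mem_union]
        constructor
        · intro h; exact ⟨fun p hp => h p (Or.inl hp), fun p hp => h p (Or.inr hp)⟩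
        · rintro ⟨h1, h2⟩ p (hp | hp)
          · exact h1 p hp
          · exact h2 p hp
      by_cases a1 : ∀ p ∈ S, ∃ j ∈ J, p ∣ n + h j <;> by_cases a2 : ∀ p ∈ T, ∃ j ∈ J, p ∣ n + h j
      · rw [if_pos a1, if_pos a2, if_pos (this.2 ⟨a1, a2⟩)]; ring
      · rw [if_neg a2, if_neg (fun h => a2 (this.1 h).2)]; ring
      · rw [if_neg a1, if_neg (fun h => a1 (this.1 h).1)]; ring
      · rw [if_neg a1, if_neg (fun h => a1 (this.1 h).1)]; ring
    rw [Finset.sum_congr rfl (fun n _ => this n), Finset.sum_comm]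
    apply Finset.sum_congr rfl
    intro S _
    rw [Finset.sum_comm]
    apply Finset.sum_congr rfl
    intro T _
    rw [← Finset.mul_sum, ← Finset.sum_filter, Finset.filter_filter]
  rw [h1, ← Finset.sum_sub_distrib]
  refine (Finset.abs_sum_le_sum_abs _ _).trans (Finset.sum_le_sum fun S hS => ?_)
  rw [← Finset.sum_sub_distrib]
  refine (Finset.abs_sum_le_sum_abs _ _).trans (Finset.sum_le_sum fun T hT => ?_)
  rw [← mul_sub, abs_mul, abs_mul]
  exact mul_le_mul_of_nonneg_left (H _ (Finset.union_subset (Finset.mem_powerset.1 hS) (Finset.mem_powerset.1 hT)))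
    (by positivity)

lemma count_class (N q c : ℕ) (hq : 0 < q) :
    |∑ n ∈ Finset.Ioc N (2 * N) with n ≡ c [MOD q], (1:ℝ) - (N:ℝ) / q| ≤ 1 := by
  rw [Finset.sum_const, nsmul_eq_mul, mul_one]
  have h1 := Nat.Ioc_filter_modEq_card N (2 * N) hq c
  have hq' : (0:ℝ) < q := by exact_mod_cast hq
  have e : ((2 * N : ℕ) - (c:ℚ)) / q - ((N:ℚ) - c) / q = N / q := by
    push_cast; ring
  have hmono : ((N:ℚ) - c) / q ≤ ((2 * N : ℕ) - (c:ℚ)) / q := by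
    have : (0:ℚ) ≤ N / q := by positivity
    linarith
  have hf := Int.floor_mono hmono
  rw [max_eq_left (by linarith)] at h1
  have h2 : (((Finset.Ioc N (2 * N)).filter (fun n => n ≡ c [MOD q])).card : ℚ) =
    (⌊((2 * N : ℕ) - (c:ℚ)) / q⌋ : ℚ) - (⌊((N:ℚ) - c) / q⌋ : ℚ) := by
    exact_mod_cast h1
  have h3 : |(((Finset.Ioc N (2 * N)).filter (fun n => n ≡ c [MOD q])).card : ℚ) - N / q| ≤ 1 := by
    rw [h2, ← e, abs_le]
    have a1 := Int.floor_le (((2 * N : ℕ) - (c:ℚ)) / q)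
    have a2 := Int.lt_floor_add_one (((2 * N : ℕ) - (c:ℚ)) / q)
    have a3 := Int.floor_le (((N:ℚ) - c) / q)
    have a4 := Int.lt_floor_add_one (((N:ℚ) - c) / q)
    constructor <;> linarith
  have h4 := (Rat.cast_le (K := ℝ)).2 h3
  push_cast at h4
  exact h4

end GPY

open Real Filter

namespace GPY

lemma union_sum (P : Finset ℕ) (F : Finset ℕ → ℝ) (hF : ∀ U, 0 ≤ F U) :
    ∑ S ∈ P.powerset, ∑ T ∈ P.powerset, F (S ∪ T) ≤ ∑ U ∈ P.powerset, 4 ^ U.card * F U := by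
  have h1 : ∀ S ∈ P.powerset, ∀ T ∈ P.powerset, F (S ∪ T) ≤
      ∑ U ∈ P.powerset, (if S ⊆ U then 1 else 0) * (if T ⊆ U then 1 else 0) * F U := by
    intro S hS T hT
    have hm : S ∪ T ∈ P.powerset := Finset.mem_powerset.2
      (Finset.union_subset (Finset.mem_powerset.1 hS) (Finset.mem_powerset.1 hT))
    have := Finset.single_le_sum (f := fun U => (if S ⊆ U then (1:ℝ) else 0) * (if T ⊆ U then 1 else 0) * F U)
      (fun U _ => mul_nonneg (mul_nonneg (by split_ifs <;> norm_num) (by split_ifs <;> norm_num)) (hF U)) hm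
    simpa [Finset.subset_union_left, Finset.subset_union_right] using this
  refine (Finset.sum_le_sum fun S hS => Finset.sum_le_sum fun T hT => h1 S hS T hT).trans ?_
  have h2 : ∑ S ∈ P.powerset, ∑ T ∈ P.powerset, ∑ U ∈ P.powerset,
      (if S ⊆ U then (1:ℝ) else 0) * (if T ⊆ U then 1 else 0) * F U =
      ∑ U ∈ P.powerset, (∑ S ∈ P.powerset, if S ⊆ U then (1:ℝ) else 0) ^ 2 * F U := by
    rw [Finset.sum_congr rfl (fun S _ => Finset.sum_comm), Finset.sum_comm]
    apply Finset.sum_congr rfl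
    intro U _
    rw [sq, Finset.sum_mul_sum, Finset.sum_mul]
    apply Finset.sum_congr rfl
    intro S _
    rw [Finset.sum_mul]
  rw [h2]
  apply Finset.sum_le_sum
  intro U hU
  apply mul_le_mul_of_nonneg_right _ (hF U)
  have h3 : P.powerset.filter (fun S => S ⊆ U) = U.powerset := by
    ext S
    simp only [Finset.mem_filter, Finset.mem_powerset]
    exact ⟨fun h => h.2, fun h => ⟨h.trans (Finset.mem_powerset.1 hU), h⟩⟩
  rw [← Finset.sum_filter, h3, Finset.sum_const, Finset.card_powerset, nsmul_eq_mul, mul_one]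
  push_cast
  rw [← pow_mul, mul_comm, pow_mul]
  norm_num

lemma pairs_bound (k : ℕ) (hk : 1 ≤ k) (P : Finset ℕ) (hP : ∀ p ∈ P, p.Prime) (hPk : ∀ p ∈ P, 2 * k < p)
    (L : ℝ) (hL : 0 ≤ L) (l : ℕ) (hl : 1 ≤ l) (E : Finset ℕ → ℝ) (hE : ∀ U, 0 ≤ E U) :
    ∑ S ∈ P.powerset, ∑ T ∈ P.powerset, |lam k P L l S| * |lam k P L l T| *
      ((k:ℝ) ^ (S ∪ T).card * E (S ∪ T)) ≤
    (L ^ l * (1 + L) ^ (2 * k)) ^ 2 *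
      ∑ U ∈ P.powerset with ell U ≤ 2 * L, ((16 * k : ℕ):ℝ) ^ U.card * E U := by
  set B := L ^ l * (1 + L) ^ (2 * k) with hB
  have hB0 : 0 ≤ B := by positivity
  have h1 : ∀ S ∈ P.powerset, ∀ T ∈ P.powerset, |lam k P L l S| * |lam k P L l T| *
      ((k:ℝ) ^ (S ∪ T).card * E (S ∪ T)) ≤
      (fun U => if ell U ≤ 2 * L then B ^ 2 * ((4 * k : ℝ) ^ U.card * E U) else 0) (S ∪ T) := by
    intro S hS T hT
    have b1 := lam_bound k hk P hP hPk L hL l hl S (Finset.mem_powerset.1 hS)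
    have b2 := lam_bound k hk P hP hPk L hL l hl T (Finset.mem_powerset.1 hT)
    have hE0 := hE (S ∪ T)
    by_cases hS' : ell S ≤ L
    · by_cases hT' : ell T ≤ L
      · rw [if_pos hS'] at b1
        rw [if_pos hT'] at b2
        have hu : ell (S ∪ T) ≤ 2 * L := by
          have : ell (S ∪ T) ≤ ell S + ell T := by
            have h3 : S ∪ T = S ∪ (T \ S) := by simp
            rw [h3, ell_union Finset.disjoint_sdiff]
            have := ell_mono (Finset.sdiff_subset : T \ S ⊆ T)
            linarith
          linarith
        simp only [if_pos hu]
        have c1 : (2:ℝ) ^ S.card ≤ 2 ^ (S ∪ T).card :=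
          pow_le_pow_right₀ (by norm_num) (Finset.card_le_card Finset.subset_union_left)
        have c2 : (2:ℝ) ^ T.card ≤ 2 ^ (S ∪ T).card :=
          pow_le_pow_right₀ (by norm_num) (Finset.card_le_card Finset.subset_union_right)
        calc _ ≤ (2 ^ S.card * B) * (2 ^ T.card * B) * ((k:ℝ) ^ (S ∪ T).card * E (S ∪ T)) := by gcongr
          _ ≤ (2 ^ (S ∪ T).card * B) * (2 ^ (S ∪ T).card * B) * ((k:ℝ) ^ (S ∪ T).card * E (S ∪ T)) := by gcongr
          _ = _ := by
            rw [mul_pow 4, show (4:ℝ) = 2 * 2 by norm_num, mul_pow 2 2]; ring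
      · rw [if_neg hT'] at b2
        have : |lam k P L l T| = 0 := le_antisymm b2 (abs_nonneg _)
        rw [this]
        simp only [mul_zero, zero_mul]
        split_ifs <;> positivity
    · rw [if_neg hS'] at b1
      have : |lam k P L l S| = 0 := le_antisymm b1 (abs_nonneg _)
      rw [this]
      simp only [zero_mul]
      split_ifs <;> positivity
  refine (Finset.sum_le_sum fun S hS => Finset.sum_le_sum fun T hT => h1 S hS T hT).trans ?_
  refine (union_sum P (fun U => if ell U ≤ 2 * L then B ^ 2 * ((4 * k : ℝ) ^ U.card * E U) else 0) ?_).trans ?_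
  · intro U
    have := hE U
    split_ifs <;> positivity
  · rw [Finset.sum_filter, Finset.mul_sum]
    apply Finset.sum_le_sum
    intro U _
    split_ifs
    · apply le_of_eq
      push_cast
      rw [mul_pow 4, mul_pow 16, show (16:ℝ) = 4 * 4 by norm_num, mul_pow 4 4]; ring
    · simp

lemma err1_bound (k : ℕ) (hk : 1 ≤ k) (P : Finset ℕ) (hP : ∀ p ∈ P, p.Prime) (hPk : ∀ p ∈ P, 2 * k < p)
    (L : ℝ) (hL : 0 ≤ L) (l : ℕ) (hl : 1 ≤ l) :
    ∑ S ∈ P.powerset, ∑ T ∈ P.powerset, |lam k P L l S| * |lam k P L l T| * ((k:ℝ) ^ (S ∪ T).card * 1) ≤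
    (L ^ l * (1 + L) ^ (2 * k)) ^ 2 * (Real.exp (2 * L) * (1 + 2 * L) ^ (16 * k)) := by
  refine (pairs_bound k hk P hP hPk L hL l hl (fun _ => 1) (fun _ => zero_le_one)).trans ?_
  apply mul_le_mul_of_nonneg_left _ (by positivity)
  refine le_trans ?_ (mul_le_mul_of_nonneg_left (M_bound P hP (2 * L) (by positivity) (16 * k)) (Real.exp_pos _).le)
  rw [Finset.mul_sum]
  apply Finset.sum_le_sum
  intro U hU
  obtain ⟨hU1, hU2⟩ := Finset.mem_filter.1 hU
  have hUP : ∀ p ∈ U, p.Prime := fun p hp => hP p (Finset.mem_powerset.1 hU1 hp)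
  have h1 : Real.exp (ell U) = ∏ p ∈ U, (p:ℝ) := by
    rw [ell_eq_log hUP, Real.exp_log]
    · push_cast; rfl
    · exact_mod_cast Nat.pos_of_ne_zero (prod_ne_zero_of_prime hUP)
  have h2 : ((16 * k : ℕ):ℝ) ^ U.card * 1 = Real.exp (ell U) * ∏ p ∈ U, (((16 * k : ℕ):ℝ) * (p:ℝ)⁻¹) := by
    rw [h1, ← Finset.prod_mul_distrib, mul_one, ← Finset.prod_const]
    apply Finset.prod_congr rfl
    intro p hp
    have : (p:ℝ) ≠ 0 := by exact_mod_cast (hUP p hp).ne_zero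
    field_simp
  rw [h2]
  exact mul_le_mul_of_nonneg_right (Real.exp_le_exp.2 hU2) (Finset.prod_nonneg fun p _ => by positivity)

lemma E_sum_bound (P : Finset ℕ) (hP : ∀ p ∈ P, p.Prime) (L : ℝ) (hL : 0 ≤ L) (K : ℕ) (T τ ε : ℝ) (hT : 0 < T)
    (hτ : 0 ≤ τ) (E : Finset ℕ → ℝ) (hE : ∀ U, 0 ≤ E U)
    (h1 : ∀ U ⊆ P, ell U ≤ 2 * L → E U ≤ τ * ∏ p ∈ U, (2 * (p:ℝ)⁻¹))
    (h2 : ∑ U ∈ P.powerset with ell U ≤ 2 * L, E U ≤ ε) :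
    ∑ U ∈ P.powerset with ell U ≤ 2 * L, (K:ℝ) ^ U.card * E U ≤
      τ * (1 + 2 * L) ^ (2 * K ^ 2) / T + T * ε := by
  have h3 := M_bound P hP (2 * L) (by positivity) (2 * K ^ 2)
  have h4 : ∀ U ∈ P.powerset.filter (fun U => ell U ≤ 2 * L), (K:ℝ) ^ U.card * E U ≤
      τ / T * (∏ p ∈ U, (((2 * K ^ 2 : ℕ):ℝ) * (p:ℝ)⁻¹)) + T * E U := by
    intro U hU
    obtain ⟨hU1, hU2⟩ := Finset.mem_filter.1 hU
    have a1 := h1 U (Finset.mem_powerset.1 hU1) hU2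
    have a0 := hE U
    have a2 : (K:ℝ) ^ U.card ≤ ((K:ℝ) ^ U.card) ^ 2 / T + T := by
      rw [← sub_nonneg]
      have : ((K:ℝ) ^ U.card) ^ 2 / T + T - (K:ℝ) ^ U.card =
        (((K:ℝ) ^ U.card - T / 2) ^ 2 + 3 / 4 * T ^ 2) / T := by field_simp; ring
      rw [this]; positivity
    calc (K:ℝ) ^ U.card * E U ≤ (((K:ℝ) ^ U.card) ^ 2 / T + T) * E U := mul_le_mul_of_nonneg_right a2 a0
      _ = ((K:ℝ) ^ U.card) ^ 2 / T * E U + T * E U := by ring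
      _ ≤ ((K:ℝ) ^ U.card) ^ 2 / T * (τ * ∏ p ∈ U, (2 * (p:ℝ)⁻¹)) + T * E U := by
        gcongr
      _ = _ := by
        have : ∏ p ∈ U, (((2 * K ^ 2 : ℕ):ℝ) * (p:ℝ)⁻¹) = ((K:ℝ) ^ U.card) ^ 2 * ∏ p ∈ U, (2 * (p:ℝ)⁻¹) := by
          rw [← pow_mul, mul_comm U.card, pow_mul, ← Finset.prod_const, ← Finset.prod_mul_distrib]
          apply Finset.prod_congr rfl
          intro p _
          push_cast; ring
        rw [this]; ring
  refine (Finset.sum_le_sum h4).trans ?_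
  rw [Finset.sum_add_distrib, ← Finset.mul_sum, ← Finset.mul_sum]
  have : τ * (1 + 2 * L) ^ (2 * K ^ 2) / T = τ / T * (1 + 2 * L) ^ (2 * K ^ 2) := by ring
  rw [this]
  gcongr

lemma argmax (x : ℝ) : ∃ a : ℕ → ℕ, (∀ q, Nat.Coprime (a q) q) ∧ ∀ q, 0 < q → ∀ c, Nat.Coprime c q →
    |chebyTheta x q c - x / (Nat.totient q)| ≤ |chebyTheta x q (a q) - x / (Nat.totient q)| := by
  have : ∀ q : ℕ, ∃ a, Nat.Coprime a q ∧ (0 < q → ∀ c, Nat.Coprime c q →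
    |chebyTheta x q c - x / (Nat.totient q)| ≤ |chebyTheta x q a - x / (Nat.totient q)|) := by
    intro q
    rcases Nat.eq_zero_or_pos q with rfl | hq
    · exact ⟨1, by simp, fun h => absurd h (lt_irrefl _)⟩
    · obtain ⟨a, ha, hmax⟩ := Finset.exists_max_image ((Finset.range q).filter (fun a => Nat.Coprime a q))
        (fun a => |chebyTheta x q a - x / (Nat.totient q)|)
        ⟨1 % q, by
          rw [Finset.mem_filter, Finset.mem_range]
          exact ⟨Nat.mod_lt _ hq, by rw [Nat.Coprime, (Nat.mod_modEq 1 q).gcd_eq]; simp⟩⟩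
      refine ⟨a, (Finset.mem_filter.1 ha).2, fun _ c hc => ?_⟩
      have h1 := hmax (c % q) (by
          rw [Finset.mem_filter, Finset.mem_range]
          exact ⟨Nat.mod_lt _ hq, by rw [Nat.Coprime, (Nat.mod_modEq c q).gcd_eq]; exact hc⟩)
      have h2 : chebyTheta x q (c % q) = chebyTheta x q c := by
        unfold chebyTheta
        simp only [Nat.mod_mod]
      rwa [h2] at h1
  choose a ha using this
  exact ⟨a, fun q => (ha q).1, fun q => (ha q).2⟩

lemma theta_triv (x : ℝ) (hx : 1 ≤ x) (q a : ℕ) (hq : 0 < q) :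
    0 ≤ chebyTheta x q a ∧ chebyTheta x q a ≤ (x / q + 1) * Real.log x := by
  constructor
  · exact Finset.sum_nonneg fun p _ => Real.log_natCast_nonneg p
  · have hlog := Real.log_nonneg hx
    have h1 : chebyTheta x q a ≤ ∑ n ∈ Finset.Ioc 0 ⌊x⌋₊ with n ≡ a [MOD q], Real.log x := by
      unfold chebyTheta
      refine (Finset.sum_le_sum (g := fun _ => Real.log x) ?_).trans
        (Finset.sum_le_sum_of_subset_of_nonneg ?_ (fun _ _ _ => hlog))
      · intro p hp
        obtain ⟨h1, h2, h3⟩ := Finset.mem_filter.1 hp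
        apply Real.log_le_log (by exact_mod_cast h2.pos)
        exact (Nat.le_floor_iff (by linarith)).1 (Finset.mem_Iic.1 h1)
      · intro p hp
        obtain ⟨h1, h2, h3⟩ := Finset.mem_filter.1 hp
        rw [Finset.mem_filter, Finset.mem_Ioc]
        exact ⟨⟨h2.pos, Finset.mem_Iic.1 h1⟩, h3⟩
    refine h1.trans ?_
    rw [Finset.sum_const, nsmul_eq_mul]
    apply mul_le_mul_of_nonneg_right _ hlog
    have h2 := Nat.Ioc_filter_modEq_card 0 ⌊x⌋₊ hq a
    have hq' : (0:ℚ) < q := by exact_mod_cast hq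
    have h3 : (((Finset.Ioc 0 ⌊x⌋₊).filter (fun n => n ≡ a [MOD q])).card : ℚ) ≤ (⌊x⌋₊:ℚ) / q + 1 := by
      have : (((Finset.Ioc 0 ⌊x⌋₊).filter (fun n => n ≡ a [MOD q])).card : ℚ) =
        ((max (⌊((⌊x⌋₊:ℚ) - a) / q⌋ - ⌊(((0:ℕ):ℚ) - a) / q⌋) 0 : ℤ) : ℚ) := by exact_mod_cast h2
      rw [this]
      push_cast
      apply max_le _ (by positivity)
      have a1 := Int.floor_le (((⌊x⌋₊:ℚ) - a) / q)
      have a2 := Int.lt_floor_add_one ((0 - (a:ℚ)) / q)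
      have a3 : ((⌊x⌋₊:ℚ) - a) / q - (0 - (a:ℚ)) / q = (⌊x⌋₊:ℚ) / q := by ring
      linarith
    have h4 := (Rat.cast_le (K := ℝ)).2 h3
    push_cast at h4
    refine h4.trans ?_
    have := Nat.floor_le (by linarith : 0 ≤ x)
    gcongr

end GPY

open Real Filter

namespace GPY

noncomputable def EE (x : ℝ) (a : ℕ → ℕ) (q : ℕ) : ℝ := |chebyTheta x q (a q) - x / (Nat.totient q)|

lemma EE_nonneg (x : ℝ) (a : ℕ → ℕ) (q : ℕ) : 0 ≤ EE x a q := abs_nonneg _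

lemma coprime_prod (W : ℕ) (U : Finset ℕ) (hWU : ∀ p ∈ U, W.Coprime p) : W.Coprime (∏ p ∈ U, p) :=
  Nat.Coprime.prod_right hWU

lemma totient_prod (U : Finset ℕ) (hU : ∀ p ∈ U, p.Prime) :
    Nat.totient (∏ p ∈ U, p) = ∏ p ∈ U, (p - 1) := by
  induction U using Finset.induction_on with
  | empty => simp
  | insert p U hp ih =>
    rw [Finset.prod_insert hp, Finset.prod_insert hp, Nat.totient_mul, 
      Nat.totient_prime (hU p (Finset.mem_insert_self _ _)), ih (fun q hq => hU q (Finset.mem_insert_of_mem hq))]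
    apply coprime_prod
    intro q hq
    rw [Nat.coprime_primes (hU p (Finset.mem_insert_self _ _)) (hU q (Finset.mem_insert_of_mem hq))]
    rintro rfl; exact hp hq

lemma totient_WU (W : ℕ) (U : Finset ℕ) (hU : ∀ p ∈ U, p.Prime) (hWU : ∀ p ∈ U, W.Coprime p) :
    (Nat.totient (W * ∏ p ∈ U, p) : ℝ) = W.totient * ∏ p ∈ U, ((p:ℝ) - 1) := by
  rw [Nat.totient_mul (coprime_prod W U hWU), totient_prod U hU]
  push_cast
  congr 1
  apply Finset.prod_congr rfl
  intro p hp
  rw [Nat.cast_sub (hU p hp).one_lt.le]; simp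

lemma EE_triv (x : ℝ) (hx : 1 ≤ x) (a : ℕ → ℕ) (W : ℕ) (hW : 0 < W) (U : Finset ℕ) (hU : ∀ p ∈ U, p.Prime)
    (hWU : ∀ p ∈ U, W.Coprime p) (hle : ((W * ∏ p ∈ U, p : ℕ) : ℝ) ≤ x) :
    EE x a (W * ∏ p ∈ U, p) ≤ (2 * Real.log x + 1) * x * ∏ p ∈ U, (2 * (p:ℝ)⁻¹) := by
  set q := W * ∏ p ∈ U, p with hq
  have hpp : 0 < ∏ p ∈ U, p := Nat.pos_of_ne_zero (prod_ne_zero_of_prime hU)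
  have hq0 : 0 < q := Nat.mul_pos hW hpp
  have hq' : (0:ℝ) < q := by exact_mod_cast hq0
  have hlog := Real.log_nonneg hx
  obtain ⟨t1, t2⟩ := theta_triv x hx q (a q) hq0
  have hW1 : (1:ℝ) ≤ W := by exact_mod_cast hW
  have hφW : (1:ℝ) ≤ W.totient := by exact_mod_cast Nat.totient_pos.2 hW
  have hp2 : ∀ p ∈ U, (2:ℝ) ≤ p := fun p hp => by exact_mod_cast (hU p hp).two_le
  have i1 : ∏ p ∈ U, (p:ℝ)⁻¹ ≤ ∏ p ∈ U, (2 * (p:ℝ)⁻¹) := by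
    apply Finset.prod_le_prod (fun p _ => by positivity)
    intro p hp
    have : (0:ℝ) ≤ (p:ℝ)⁻¹ := by positivity
    linarith
  have i2 : ((q:ℝ))⁻¹ ≤ ∏ p ∈ U, (2 * (p:ℝ)⁻¹) := by
    refine le_trans ?_ i1
    rw [hq]
    push_cast
    rw [mul_inv, Finset.prod_inv_distrib]
    have : (W:ℝ)⁻¹ ≤ 1 := inv_le_one_of_one_le₀ hW1
    exact mul_le_of_le_one_left (inv_nonneg.2 (Finset.prod_nonneg fun p _ => by positivity)) this
  have i3 : (q.totient:ℝ)⁻¹ ≤ ∏ p ∈ U, (2 * (p:ℝ)⁻¹) := by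
    rw [hq, totient_WU W U hU hWU, mul_inv, ← Finset.prod_inv_distrib]
    have h1 : (W.totient:ℝ)⁻¹ ≤ 1 := inv_le_one_of_one_le₀ hφW
    refine (mul_le_of_le_one_left (Finset.prod_nonneg fun p hp => ?_) h1).trans ?_
    · have := hp2 p hp
      exact inv_nonneg.2 (by linarith)
    · apply Finset.prod_le_prod
      · intro p hp
        have := hp2 p hp
        exact inv_nonneg.2 (by linarith)
      · intro p hp
        have := hp2 p hp
        have h3 : (0:ℝ) < p - 1 := by linarith
        rw [← div_eq_mul_inv, inv_eq_one_div, div_le_div_iff₀ h3 (by linarith)]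
        linarith
  have hx1 : x / q + 1 ≤ 2 * (x * (q:ℝ)⁻¹) := by
    have : 1 ≤ x * (q:ℝ)⁻¹ := by rw [← div_eq_mul_inv, le_div_iff₀ hq']; linarith
    rw [div_eq_mul_inv]; linarith
  have hx0 : 0 ≤ x / (q.totient:ℝ) := by positivity
  calc EE x a q ≤ chebyTheta x q (a q) + x / q.totient := by
        unfold EE
        rw [abs_le]; constructor <;> linarith
    _ ≤ 2 * (x * (q:ℝ)⁻¹) * Real.log x + x * (q.totient:ℝ)⁻¹ := by
        rw [div_eq_mul_inv x (q.totient:ℝ)]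
        have := mul_le_mul_of_nonneg_right hx1 hlog
        linarith
    _ ≤ 2 * (x * ∏ p ∈ U, (2 * (p:ℝ)⁻¹)) * Real.log x + x * ∏ p ∈ U, (2 * (p:ℝ)⁻¹) := by gcongr
    _ = _ := by ring

lemma prod_le_exp (U : Finset ℕ) (hU : ∀ p ∈ U, p.Prime) (u : ℝ) (h : ell U ≤ u) :
    ((∏ p ∈ U, p : ℕ):ℝ) ≤ Real.exp u := by
  have h0 : (0:ℝ) < ((∏ p ∈ U, p : ℕ):ℝ) := by
    exact_mod_cast Nat.pos_of_ne_zero (prod_ne_zero_of_prime hU)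
  rw [← Real.log_le_iff_le_exp h0, ← ell_eq_log hU]
  exact h

lemma level_sum (x : ℝ) (a : ℕ → ℕ) (W : ℕ) (hW : 0 < W) (P : Finset ℕ) (hP : ∀ p ∈ P, p.Prime)
    (u Y : ℝ) (hY : W * Real.exp u ≤ Y) :
    ∑ U ∈ P.powerset with ell U ≤ u, EE x a (W * ∏ p ∈ U, p) ≤
      ∑ q ∈ Finset.Icc 1 ⌊Y⌋₊, |chebyTheta x q (a q) - x / (Nat.totient q)| := by
  have hY0 : 0 ≤ Y := le_trans (by positivity) hY
  have hinj : Set.InjOn (fun U : Finset ℕ => W * ∏ p ∈ U, p) (P.powerset.filter (fun U => ell U ≤ u)) := by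
    intro U hU V hV hUV
    have hU1 := (Finset.mem_powerset.1 (Finset.mem_filter.1 (Finset.mem_coe.1 hU)).1)
    have hV1 := (Finset.mem_powerset.1 (Finset.mem_filter.1 (Finset.mem_coe.1 hV)).1)
    have h1 : ∏ p ∈ U, p = ∏ p ∈ V, p := Nat.eq_of_mul_eq_mul_left hW hUV
    rw [← Nat.primeFactors_prod (fun p hp => hP p (hU1 hp)), ← Nat.primeFactors_prod (fun p hp => hP p (hV1 hp)), h1]
  have := Finset.sum_image (f := fun q => EE x a q) hinj
  rw [← this]
  apply Finset.sum_le_sum_of_subset_of_nonneg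
  · intro q hq
    obtain ⟨U, hU, rfl⟩ := Finset.mem_image.1 hq
    obtain ⟨hU1, hU2⟩ := Finset.mem_filter.1 hU
    have hUP : ∀ p ∈ U, p.Prime := fun p hp => hP p (Finset.mem_powerset.1 hU1 hp)
    rw [Finset.mem_Icc]
    refine ⟨Nat.mul_pos hW (Nat.pos_of_ne_zero (prod_ne_zero_of_prime hUP)), Nat.le_floor ?_⟩
    refine le_trans ?_ hY
    rw [Nat.cast_mul]
    exact mul_le_mul_of_nonneg_left (prod_le_exp U hUP u hU2) (by positivity)
  · intro q _ _
    exact abs_nonneg _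

lemma theta_diff (N q c s : ℕ) :
    ∑ n ∈ Finset.Ioc N (2 * N) with n ≡ c [MOD q], (if (n + s).Prime then Real.log ((n + s : ℕ):ℝ) else 0) =
      chebyTheta ((2 * N + s : ℕ):ℝ) q (c + s) - chebyTheta ((N + s : ℕ):ℝ) q (c + s) := by
  unfold chebyTheta
  rw [Nat.floor_natCast, Nat.floor_natCast, eq_sub_iff_add_eq]
  have hsub : (Finset.Iic (N + s)).filter (fun p => p.Prime ∧ p % q = (c + s) % q) ⊆
      (Finset.Iic (2 * N + s)).filter (fun p => p.Prime ∧ p % q = (c + s) % q) := by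
    apply Finset.filter_subset_filter
    apply Finset.Iic_subset_Iic.2; omega
  rw [← Finset.sum_sdiff hsub]
  congr 1
  rw [← Finset.sum_filter, Finset.filter_filter]
  apply Finset.sum_bij (fun n _ => n + s)
  · intro n hn
    simp only [Finset.mem_filter, Finset.mem_Ioc, Finset.mem_sdiff, Finset.mem_Iic] at hn ⊢
    obtain ⟨⟨h1, h2⟩, h3, h4⟩ := hn
    refine ⟨⟨by omega, h4, h3.add_right s⟩, fun h => by omega⟩
  · intro n _ m _ h; omega
  · intro p hp
    simp only [Finset.mem_filter, Finset.mem_Ioc, Finset.mem_sdiff, Finset.mem_Iic] at hp ⊢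
    obtain ⟨⟨h1, h2, h3⟩, h4⟩ := hp
    have h5 : N + s < p := by
      by_contra h
      exact h4 ⟨by omega, h2, h3⟩
    refine ⟨p - s, ⟨⟨by omega, by omega⟩, ?_, ?_⟩, by omega⟩
    · have : p - s + s ≡ c + s [MOD q] := by rw [Nat.sub_add_cancel (by omega)]; exact h3
      exact Nat.ModEq.add_right_cancel' s this
    · rw [Nat.sub_add_cancel (by omega)]; exact h2
  · intro n _; rfl

lemma theta_diff_bound (N q c s : ℕ) (hq : 0 < q) (a1 a2 : ℕ → ℕ) (hc : Nat.Coprime (c + s) q)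
    (h1 : ∀ q, 0 < q → ∀ c, Nat.Coprime c q →
      |chebyTheta ((2 * N + s : ℕ):ℝ) q c - ((2 * N + s : ℕ):ℝ) / (Nat.totient q)| ≤ EE ((2 * N + s : ℕ):ℝ) a1 q)
    (h2 : ∀ q, 0 < q → ∀ c, Nat.Coprime c q →
      |chebyTheta ((N + s : ℕ):ℝ) q c - ((N + s : ℕ):ℝ) / (Nat.totient q)| ≤ EE ((N + s : ℕ):ℝ) a2 q) :
    |∑ n ∈ Finset.Ioc N (2 * N) with n ≡ c [MOD q], (if (n + s).Prime then Real.log ((n + s : ℕ):ℝ) else 0) -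
      (N:ℝ) / q.totient| ≤ EE ((2 * N + s : ℕ):ℝ) a1 q + EE ((N + s : ℕ):ℝ) a2 q := by
  rw [theta_diff]
  have b1 := abs_le.1 (h1 q hq _ hc)
  have b2 := abs_le.1 (h2 q hq _ hc)
  have e : ((2 * N + s : ℕ):ℝ) / q.totient - ((N + s : ℕ):ℝ) / q.totient = (N:ℝ) / q.totient := by
    push_cast; ring
  rw [abs_le, ← e]
  constructor <;> linarith [b1.1, b1.2, b2.1, b2.2]

end GPY

open Real Filter

namespace GPY

noncomputable def wt {k : ℕ} (h : Fin k → ℕ) (P : Finset ℕ) (lm : Finset ℕ → ℝ) (n : ℕ) : ℝ :=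
  (∑ S ∈ P.powerset with ∀ p ∈ S, ∃ j ∈ (Finset.univ : Finset (Fin k)), p ∣ n + h j, lm S) ^ 2

lemma S1_upper {k : ℕ} (hk : 1 ≤ k) (h : Fin k → ℕ) (hinj : Function.Injective h) (W b N : ℕ) (hW : 0 < W)
    (P : Finset ℕ) (hP : ∀ p ∈ P, p.Prime) (hPk : ∀ p ∈ P, 2 * k < p) (hPW : ∀ p ∈ P, W.Coprime p)
    (hPh : ∀ p ∈ P, ∀ i, h i < p) (L : ℝ) (hL : 0 ≤ L) (l : ℕ) (hl : 1 ≤ l) :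
    ∑ n ∈ Finset.Ioc N (2 * N) with n ≡ b [MOD W], wt h P (lam k P L l) n ≤
      (N:ℝ) / W * TT P (fun p => (k:ℝ) / (p - k)) L (2 * l) +
      (L ^ l * (1 + L) ^ (2 * k)) ^ 2 * (Real.exp (2 * L) * (1 + 2 * L) ^ (16 * k)) := by
  have key := expand h Finset.univ P (Finset.Ioc N (2 * N)) (fun _ => 1) W b (lam k P L l)
    (fun U => (k:ℝ) ^ U.card * ((N:ℝ) / ((W * ∏ p ∈ U, p : ℕ):ℝ))) (fun U => (k:ℝ) ^ U.card * 1) (by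
      intro U hU
      have := count h hinj Finset.univ (Finset.Ioc N (2 * N)) (fun _ => 1) ((N:ℝ) / ((W * ∏ p ∈ U, p : ℕ):ℝ)) 1 U W b
        (fun p hp => ⟨hP p (hU hp), hPW p (hU hp), hPh p (hU hp)⟩)
        (fun i hi => absurd (Finset.mem_univ i) hi)
        (fun c _ => count_class N _ c (Nat.mul_pos hW (Nat.pos_of_ne_zero
          (prod_ne_zero_of_prime fun p hp => hP p (hU hp)))))
      rw [Finset.card_univ, Fintype.card_fin] at this
      exact this)
  simp only [one_mul] at key
  have e1 := err1_bound k hk P hP hPk L hL l hl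
  have e2 := Q1_eq k hk P (fun p hp => by have := hPk p hp; omega) L l
  have e3 : ∑ S ∈ P.powerset, ∑ T ∈ P.powerset, lam k P L l S * lam k P L l T *
      ((k:ℝ) ^ (S ∪ T).card * ((N:ℝ) / ((W * ∏ p ∈ S ∪ T, p : ℕ):ℝ))) =
      (N:ℝ) / W * TT P (fun p => (k:ℝ) / (p - k)) L (2 * l) := by
    rw [← e2, Finset.mul_sum]
    apply Finset.sum_congr rfl
    intro S _
    rw [Finset.mul_sum]
    apply Finset.sum_congr rfl
    intro T _
    have : ∏ p ∈ S ∪ T, ((p:ℝ) / k)⁻¹ = (k:ℝ) ^ (S ∪ T).card / ∏ p ∈ S ∪ T, (p:ℝ) := by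
      rw [← Finset.prod_const, ← Finset.prod_div_distrib]
      apply Finset.prod_congr rfl
      intro p _
      rw [inv_div]
    rw [this]
    push_cast
    rw [div_mul_eq_div_div]
    ring
  rw [e3] at key
  have := (abs_le.1 key).2
  unfold wt
  linarith

lemma S2_lower {k : ℕ} (hk : 2 ≤ k) (h : Fin k → ℕ) (hinj : Function.Injective h) (W b N : ℕ) (hW : 0 < W)
    (P Q : Finset ℕ) (hP : ∀ p ∈ P, p.Prime) (hPk : ∀ p ∈ P, 2 * k < p) (hPW : ∀ p ∈ P, W.Coprime p)
    (hPh : ∀ p ∈ P, ∀ i, h i < p) (L : ℝ) (hL : 0 ≤ L) (l : ℕ) (hl : 1 ≤ l)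
    (hQ : ∀ p ∈ Q, p.Prime) (hd : Disjoint Q P)
    (hc : ∀ p : ℕ, p.Prime → (p:ℝ) ≤ Real.exp L → p ∈ Q ∪ P) (hPN : ∀ p ∈ P, p ≤ N)
    (i : Fin k) (hb : Nat.Coprime (b + h i) W) (a1 a2 : ℕ → ℕ)
    (h1 : ∀ q, 0 < q → ∀ c, Nat.Coprime c q →
      |chebyTheta ((2 * N + h i : ℕ):ℝ) q c - ((2 * N + h i : ℕ):ℝ) / (Nat.totient q)| ≤
        EE ((2 * N + h i : ℕ):ℝ) a1 q)
    (h2 : ∀ q, 0 < q → ∀ c, Nat.Coprime c q →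
      |chebyTheta ((N + h i : ℕ):ℝ) q c - ((N + h i : ℕ):ℝ) / (Nat.totient q)| ≤
        EE ((N + h i : ℕ):ℝ) a2 q) :
    (N:ℝ) / W.totient * ((∏ p ∈ Q, (1 - (p:ℝ)⁻¹)) ^ 2 / (l + 1) ^ 2 *
      TT P (fun p => ((k:ℝ) - 1) / (p - k)) L (2 * l + 2)) -
      (L ^ l * (1 + L) ^ (2 * k)) ^ 2 *
      (∑ U ∈ P.powerset with ell U ≤ 2 * L, ((16 * k : ℕ):ℝ) ^ U.card * EE ((2 * N + h i : ℕ):ℝ) a1 (W * ∏ p ∈ U, p)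
       + ∑ U ∈ P.powerset with ell U ≤ 2 * L, ((16 * k : ℕ):ℝ) ^ U.card * EE ((N + h i : ℕ):ℝ) a2 (W * ∏ p ∈ U, p))
    ≤ ∑ n ∈ Finset.Ioc N (2 * N) with n ≡ b [MOD W],
        (if (n + h i).Prime then Real.log ((n + h i : ℕ):ℝ) else 0) * wt h P (lam k P L l) n := by
  set E : Finset ℕ → ℝ := fun U => EE ((2 * N + h i : ℕ):ℝ) a1 (W * ∏ p ∈ U, p) +
    EE ((N + h i : ℕ):ℝ) a2 (W * ∏ p ∈ U, p) with hE
  have hE0 : ∀ U, 0 ≤ E U := fun U => add_nonneg (EE_nonneg _ _ _) (EE_nonneg _ _ _)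
  set g : ℕ → ℝ := fun n => if (n + h i).Prime then Real.log ((n + h i : ℕ):ℝ) else 0 with hg
  set J : Finset (Fin k) := Finset.univ.erase i with hJ
  have hJc : (J.card:ℝ) = (k:ℝ) - 1 := by
    rw [hJ, Finset.card_erase_of_mem (Finset.mem_univ i), Finset.card_univ, Fintype.card_fin,
      Nat.cast_sub (by omega)]
    simp
  have hk0 : (2:ℝ) ≤ k := by exact_mod_cast hk
  have hnJ : ∀ j ∉ J, j = i := by
    intro j hj
    by_contra hne
    exact hj (Finset.mem_erase.2 ⟨hne, Finset.mem_univ j⟩)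
  have key := expand h J P (Finset.Ioc N (2 * N)) g W b (lam k P L l)
    (fun U => ((k:ℝ) - 1) ^ U.card * ((N:ℝ) / ((W * ∏ p ∈ U, p : ℕ).totient:ℝ)))
    (fun U => ((k:ℝ) - 1) ^ U.card * E U) (by
      intro U hU
      have := count h hinj J (Finset.Ioc N (2 * N)) g ((N:ℝ) / ((W * ∏ p ∈ U, p : ℕ).totient:ℝ)) (E U) U W b
        (fun p hp => ⟨hP p (hU hp), hPW p (hU hp), hPh p (hU hp)⟩)
        (fun j hj => by rw [hnJ j hj]; exact hb)
        (fun c hc => theta_diff_bound N _ c (h i) (Nat.mul_pos hW (Nat.pos_of_ne_zero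
          (prod_ne_zero_of_prime fun p hp => hP p (hU hp)))) a1 a2 (hc i (by simp [hJ])) h1 h2)
      rw [hJc] at this
      exact this)
  have e0 : ∑ n ∈ Finset.Ioc N (2 * N) with n ≡ b [MOD W], g n * wt h P (lam k P L l) n =
      ∑ n ∈ Finset.Ioc N (2 * N) with n ≡ b [MOD W], g n *
        (∑ S ∈ P.powerset with ∀ p ∈ S, ∃ j ∈ J, p ∣ n + h j, lam k P L l S) ^ 2 := by
    apply Finset.sum_congr rfl
    intro n hn
    have hnN : N < n := (Finset.mem_Ioc.1 (Finset.mem_filter.1 hn).1).1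
    by_cases hpr : (n + h i).Prime
    · unfold wt
      congr 3
      apply Finset.filter_congr
      intro S hS
      apply forall₂_congr
      intro p hp
      constructor
      · rintro ⟨j, _, hj⟩
        refine ⟨j, Finset.mem_erase.2 ⟨?_, Finset.mem_univ j⟩, hj⟩
        rintro rfl
        have hpP := Finset.mem_powerset.1 hS hp
        rcases (Nat.dvd_prime hpr).1 hj with h3 | h3
        · exact (hP p hpP).one_lt.ne' h3
        · have := hPN p hpP
          omega
      · rintro ⟨j, _, hj⟩
        exact ⟨j, Finset.mem_univ j, hj⟩
    · simp [hg, hpr]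
  have e2 := Q2_lower k hk P Q (fun p hp => by have := hPk p hp; omega) hP hQ hd L hc l hl
  have e3 : ∑ S ∈ P.powerset, ∑ T ∈ P.powerset, lam k P L l S * lam k P L l T *
      (((k:ℝ) - 1) ^ (S ∪ T).card * ((N:ℝ) / ((W * ∏ p ∈ S ∪ T, p : ℕ).totient:ℝ))) =
      (N:ℝ) / W.totient * ∑ S ∈ P.powerset, ∑ T ∈ P.powerset, lam k P L l S * lam k P L l T *
      ∏ p ∈ S ∪ T, (((p:ℝ) - 1) / (k - 1))⁻¹ := by
    rw [Finset.mul_sum]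
    apply Finset.sum_congr rfl
    intro S hS
    rw [Finset.mul_sum]
    apply Finset.sum_congr rfl
    intro T hT
    have hST : S ∪ T ⊆ P := Finset.union_subset (Finset.mem_powerset.1 hS) (Finset.mem_powerset.1 hT)
    have : ∏ p ∈ S ∪ T, (((p:ℝ) - 1) / (k - 1))⁻¹ = ((k:ℝ) - 1) ^ (S ∪ T).card / ∏ p ∈ S ∪ T, ((p:ℝ) - 1) := by
      rw [← Finset.prod_const, ← Finset.prod_div_distrib]
      apply Finset.prod_congr rfl
      intro p _
      rw [inv_div]
    rw [this, totient_WU W _ (fun p hp => hP p (hST hp)) (fun p hp => hPW p (hST hp)), div_mul_eq_div_div]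
    ring
  have e4 : ∑ S ∈ P.powerset, ∑ T ∈ P.powerset, |lam k P L l S| * |lam k P L l T| *
      (((k:ℝ) - 1) ^ (S ∪ T).card * E (S ∪ T)) ≤ ∑ S ∈ P.powerset, ∑ T ∈ P.powerset,
        |lam k P L l S| * |lam k P L l T| * ((k:ℝ) ^ (S ∪ T).card * E (S ∪ T)) := by
    apply Finset.sum_le_sum
    intro S _
    apply Finset.sum_le_sum
    intro T _
    apply mul_le_mul_of_nonneg_left _ (by positivity)
    apply mul_le_mul_of_nonneg_right _ (hE0 _)
    exact pow_le_pow_left₀ (by linarith) (by linarith) _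
  have e5 := pairs_bound k (by omega) P hP hPk L hL l hl E hE0
  have e6 : ∑ U ∈ P.powerset with ell U ≤ 2 * L, ((16 * k : ℕ):ℝ) ^ U.card * E U =
      ∑ U ∈ P.powerset with ell U ≤ 2 * L, ((16 * k : ℕ):ℝ) ^ U.card * EE ((2 * N + h i : ℕ):ℝ) a1 (W * ∏ p ∈ U, p)
       + ∑ U ∈ P.powerset with ell U ≤ 2 * L, ((16 * k : ℕ):ℝ) ^ U.card * EE ((N + h i : ℕ):ℝ) a2 (W * ∏ p ∈ U, p) := by
    rw [← Finset.sum_add_distrib]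
    apply Finset.sum_congr rfl
    intro U _
    rw [hE]; ring
  rw [e6] at e5
  rw [e3] at key
  rw [e0]
  have e7 := mul_le_mul_of_nonneg_left e2 (by positivity : 0 ≤ (N:ℝ) / W.totient)
  have := (abs_le.1 key).1
  linarith

end GPY

open Real Filter

namespace GPY

lemma ev_W (W : ℝ) (c d : ℝ) (hcd : c < d) : ∀ᶠ N : ℕ in atTop, W * (N:ℝ) ^ c ≤ (N:ℝ) ^ d := by
  have h1 : Tendsto (fun N : ℕ => (N:ℝ) ^ (d - c)) atTop atTop :=
    (tendsto_rpow_atTop (by linarith)).comp tendsto_natCast_atTop_atTop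
  filter_upwards [h1.eventually_ge_atTop W, eventually_gt_atTop 0] with N h2 h3
  have hN : (0:ℝ) < N := by exact_mod_cast h3
  calc W * (N:ℝ) ^ c ≤ (N:ℝ) ^ (d - c) * (N:ℝ) ^ c := by gcongr
    _ = _ := by rw [← Real.rpow_add hN]; congr 1; ring

lemma ev_log (c : ℝ) : ∀ᶠ N : ℕ in atTop, c ≤ Real.log N :=
  (Real.tendsto_log_atTop.comp tendsto_natCast_atTop_atTop).eventually_ge_atTop c

lemma ev_polylog (m : ℕ) (c : ℝ) (hc : 0 < c) : ∀ᶠ N : ℕ in atTop, (2 * Real.log N) ^ m ≤ (N:ℝ) ^ c := by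
  have h1 := isLittleO_log_rpow_rpow_atTop (m:ℝ) hc
  have h2 := (h1.comp_tendsto tendsto_natCast_atTop_atTop).def (by positivity : (0:ℝ) < ((2:ℝ) ^ m)⁻¹)
  filter_upwards [h2, ev_log 1] with N h3 h4
  simp only [Function.comp, Real.rpow_natCast, norm_pow, Real.norm_eq_abs] at h3
  rw [abs_of_nonneg (by linarith), abs_of_nonneg (by positivity), inv_mul_eq_div, le_div_iff₀ (by positivity)] at h3
  rw [mul_pow]; linarith

lemma exp_L (ρ : ℝ) (N : ℕ) (hN : 0 < N) : Real.exp (2 * (ρ * Real.log N)) = (N:ℝ) ^ (2 * ρ) := by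
  rw [Real.rpow_def_of_pos (by exact_mod_cast hN)]; congr 1; ring

lemma err2 (ϑ : ℝ)
    (hlevel : ∀ A > (0 : ℝ), ∀ ε > (0 : ℝ), ∃ C > (0 : ℝ), ∀ x : ℝ, x ≥ 2 →
      ∀ a : ℕ → ℕ, (∀ q, Nat.Coprime (a q) q) →
        ∑ q ∈ Finset.Icc 1 ⌊x ^ (ϑ - ε)⌋₊,
          |chebyTheta x q (a q) - x / (Nat.totient q)| ≤ C * x / (Real.log x) ^ A)
    (ρ : ℝ) (hρ0 : 0 < ρ) (hρ : ρ < 1 / 2) (hρϑ : 2 * ρ < ϑ) (k l W : ℕ) (hW : 0 < W) :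
    ∃ C' : ℝ, 0 < C' ∧ ∀ᶠ N : ℕ in atTop, ∀ x : ℝ, (N:ℝ) ≤ x → x ≤ 3 * N → ∀ a : ℕ → ℕ, (∀ q, Nat.Coprime (a q) q) →
      ∀ P : Finset ℕ, (∀ p ∈ P, p.Prime) → (∀ p ∈ P, W.Coprime p) →
      ((ρ * Real.log N) ^ l * (1 + ρ * Real.log N) ^ (2 * k)) ^ 2 *
        ∑ U ∈ P.powerset with ell U ≤ 2 * (ρ * Real.log N),
          ((16 * k : ℕ):ℝ) ^ U.card * EE x a (W * ∏ p ∈ U, p) ≤ C' * N := by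
  set K := 16 * k with hK
  set M := 2 * l + 4 * k + (2 * K ^ 2 + 1) with hM
  obtain ⟨C, hC, hlev⟩ := hlevel ((2 * M : ℕ):ℝ) (by positivity) ((ϑ - 2 * ρ) / 2) (by linarith)
  refine ⟨(15 + 3 * C) * 2 ^ M, by positivity, ?_⟩
  filter_upwards [ev_log 1, ev_W W (2 * ρ) (ϑ - (ϑ - 2 * ρ) / 2) (by linarith), ev_W W (2 * ρ) 1 (by linarith),
    eventually_ge_atTop 3] with N hlg hW1 hW2 hN3 x hNx hx3 a ha P hP hPW
  have hN0 : 0 < N := by omega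
  have hN3' : (3:ℝ) ≤ N := by exact_mod_cast hN3
  set lg := Real.log N with hlgd
  set L := ρ * lg with hL
  have hL0 : 0 ≤ L := by positivity
  have hL1 : L ≤ lg / 2 := by rw [hL]; nlinarith
  have hx1 : 1 ≤ x := by linarith
  have hlx1 : lg ≤ Real.log x := Real.log_le_log (by linarith) hNx
  have hlx2 : Real.log x ≤ 2 * lg := by
    calc Real.log x ≤ Real.log (N * N) := Real.log_le_log (by linarith) (by nlinarith)
      _ = 2 * lg := by rw [Real.log_mul (by linarith) (by linarith)]; ring
  have hexp := exp_L ρ N hN0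
  rw [← hlgd, ← hL] at hexp
  have hY : W * Real.exp (2 * L) ≤ x ^ (ϑ - (ϑ - 2 * ρ) / 2) := by
    rw [hexp]
    exact hW1.trans (Real.rpow_le_rpow (by linarith) hNx (by linarith))
  have htriv : ∀ U ⊆ P, ell U ≤ 2 * L → EE x a (W * ∏ p ∈ U, p) ≤ (15 * lg * N) * ∏ p ∈ U, (2 * (p:ℝ)⁻¹) := by
    intro U hU hUL
    have hUP : ∀ p ∈ U, p.Prime := fun p hp => hP p (hU hp)
    refine (EE_triv x hx1 a W hW U hUP (fun p hp => hPW p (hU hp)) ?_).trans ?_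
    · rw [Nat.cast_mul]
      calc (W:ℝ) * ((∏ p ∈ U, p : ℕ):ℝ) ≤ W * Real.exp (2 * L) :=
            mul_le_mul_of_nonneg_left (prod_le_exp U hUP _ hUL) (by positivity)
        _ ≤ (N:ℝ) ^ (1:ℝ) := by rw [hexp]; exact hW2
        _ ≤ x := by rw [Real.rpow_one]; exact hNx
    · apply mul_le_mul_of_nonneg_right _ (Finset.prod_nonneg fun p _ => by positivity)
      calc (2 * Real.log x + 1) * x ≤ (5 * lg) * (3 * N) := by
            apply mul_le_mul _ hx3 (by linarith) (by positivity)
            linarith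
        _ = _ := by ring
  have hsum : ∑ U ∈ P.powerset with ell U ≤ 2 * L, EE x a (W * ∏ p ∈ U, p) ≤ 3 * C * N / lg ^ (2 * M) := by
    refine (level_sum x a W hW P hP (2 * L) _ hY).trans ((hlev x (by linarith) a ha).trans ?_)
    rw [Real.rpow_natCast]
    have : lg ^ (2 * M) ≤ Real.log x ^ (2 * M) := pow_le_pow_left₀ (by linarith) hlx1 _
    have h2 : C * x ≤ 3 * C * N := by nlinarith
    exact div_le_div₀ (by positivity) h2 (by positivity) this
  have main := E_sum_bound P hP L hL0 K (lg ^ M) (15 * lg * N) _ (by positivity) (by positivity)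
    (fun U => EE x a (W * ∏ p ∈ U, p)) (fun U => EE_nonneg _ _ _) htriv hsum
  have b1 : (1 + 2 * L) ^ (2 * K ^ 2) ≤ (2 * lg) ^ (2 * K ^ 2) := pow_le_pow_left₀ (by positivity) (by linarith) _
  have b2 : (L ^ l * (1 + L) ^ (2 * k)) ^ 2 ≤ (2 * lg) ^ (2 * l + 4 * k) := by
    calc (L ^ l * (1 + L) ^ (2 * k)) ^ 2 ≤ ((2 * lg) ^ l * (2 * lg) ^ (2 * k)) ^ 2 := by
          gcongr <;> linarith
      _ = _ := by ring
  have hlg0 : 0 < lg := by linarith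
  have b3 : 15 * lg * N * (1 + 2 * L) ^ (2 * K ^ 2) / lg ^ M + lg ^ M * (3 * C * N / lg ^ (2 * M)) ≤
      (15 + 3 * C) * N * (2 * lg) ^ (2 * K ^ 2 + 1) / lg ^ M := by
    have c1 : lg ^ M * (3 * C * N / lg ^ (2 * M)) = 3 * C * N * 1 / lg ^ M := by
      have : lg ^ (2 * M) = lg ^ M * lg ^ M := by rw [two_mul, pow_add]
      rw [this]
      have h0 : lg ^ M ≠ 0 := by positivity
      generalize lg ^ M = y at *
      field_simp
    rw [c1, ← add_div]
    apply div_le_div_of_nonneg_right _ (by positivity)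
    have c2 : (1:ℝ) ≤ (2 * lg) ^ (2 * K ^ 2 + 1) := one_le_pow₀ (by linarith)
    have c3 : lg * (1 + 2 * L) ^ (2 * K ^ 2) ≤ (2 * lg) ^ (2 * K ^ 2 + 1) := by
      rw [pow_succ, mul_comm]
      exact mul_le_mul b1 (by linarith) hlg0.le (pow_nonneg (by linarith) _)
    calc 15 * lg * N * (1 + 2 * L) ^ (2 * K ^ 2) + 3 * C * N * 1
        = 15 * N * (lg * (1 + 2 * L) ^ (2 * K ^ 2)) + 3 * C * N * 1 := by ring
      _ ≤ 15 * N * (2 * lg) ^ (2 * K ^ 2 + 1) + 3 * C * N * (2 * lg) ^ (2 * K ^ 2 + 1) := by gcongr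
      _ = _ := by ring
  calc _ ≤ (2 * lg) ^ (2 * l + 4 * k) * ((15 + 3 * C) * N * (2 * lg) ^ (2 * K ^ 2 + 1) / lg ^ M) := by
        apply mul_le_mul b2 (main.trans b3) _ (by positivity)
        exact Finset.sum_nonneg fun U _ => mul_nonneg (by positivity) (EE_nonneg _ _ _)
    _ = (15 + 3 * C) * N * ((2 * lg) ^ M / lg ^ M) := by rw [hM, pow_add (2 * lg) (2 * l + 4 * k)]; ring
    _ = _ := by rw [mul_pow]; field_simp

lemma err1 (ρ : ℝ) (hρ0 : 0 < ρ) (hρ : ρ < 1 / 2) (k l : ℕ) :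
    ∀ᶠ N : ℕ in atTop, Real.log (3 * N) * (((ρ * Real.log N) ^ l * (1 + ρ * Real.log N) ^ (2 * k)) ^ 2 *
      (Real.exp (2 * (ρ * Real.log N)) * (1 + 2 * (ρ * Real.log N)) ^ (16 * k))) ≤ N := by
  filter_upwards [ev_log 1, ev_polylog (1 + (2 * l + 4 * k) + 16 * k) (1 - 2 * ρ) (by linarith),
    eventually_ge_atTop 3] with N hlg hp hN3
  have hN0 : 0 < N := by omega
  have hN3' : (3:ℝ) ≤ N := by exact_mod_cast hN3
  rw [exp_L ρ N hN0]
  set lg := Real.log N with hlgd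
  set L := ρ * lg with hL
  have hL0 : 0 ≤ L := by positivity
  have hL1 : L ≤ lg / 2 := by rw [hL]; nlinarith
  have b0 : Real.log (3 * N) ≤ 2 * lg := by
    calc Real.log (3 * N) ≤ Real.log (N * N) := Real.log_le_log (by linarith) (by nlinarith)
      _ = 2 * lg := by rw [Real.log_mul (by linarith) (by linarith)]; ring
  have b1 : (1 + 2 * L) ^ (16 * k) ≤ (2 * lg) ^ (16 * k) := pow_le_pow_left₀ (by positivity) (by linarith) _
  have b2 : (L ^ l * (1 + L) ^ (2 * k)) ^ 2 ≤ (2 * lg) ^ (2 * l + 4 * k) := by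
    calc (L ^ l * (1 + L) ^ (2 * k)) ^ 2 ≤ ((2 * lg) ^ l * (2 * lg) ^ (2 * k)) ^ 2 := by
          gcongr <;> linarith
      _ = _ := by ring
  calc _ ≤ (2 * lg) * ((2 * lg) ^ (2 * l + 4 * k) * ((N:ℝ) ^ (2 * ρ) * (2 * lg) ^ (16 * k))) := by gcongr
    _ = (2 * lg) ^ (1 + (2 * l + 4 * k) + 16 * k) * (N:ℝ) ^ (2 * ρ) := by
      rw [pow_add (2 * lg) (1 + (2 * l + 4 * k)), pow_add (2 * lg) 1, pow_one]; ring
    _ ≤ (N:ℝ) ^ (1 - 2 * ρ) * (N:ℝ) ^ (2 * ρ) := by gcongr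
    _ = N := by rw [← Real.rpow_add (by linarith)]; norm_num

end GPY

open Real Filter

namespace GPY

lemma exists_b {k : ℕ} (h : Fin k → ℕ) (hadm : ∀ p : ℕ, p.Prime → ∃ r : ZMod p, ∀ i, ((h i : ℕ) : ZMod p) ≠ r)
    (Q : Finset ℕ) (hQ : ∀ p ∈ Q, p.Prime) : ∃ b, ∀ p ∈ Q, ∀ i, ¬ p ∣ b + h i := by
  induction Q using Finset.induction_on with
  | empty => exact ⟨0, by simp⟩
  | insert p Q hp ih =>
    obtain ⟨b, hb⟩ := ih (fun q hq => hQ q (Finset.mem_insert_of_mem hq))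
    have hpp := hQ p (Finset.mem_insert_self _ _)
    obtain ⟨r, hr⟩ := hadm p hpp
    haveI : NeZero p := ⟨hpp.ne_zero⟩
    have hcop : (∏ q ∈ Q, q).Coprime p := by
      rw [Nat.coprime_comm]
      apply coprime_prod
      intro q hq
      rw [Nat.coprime_primes hpp (hQ q (Finset.mem_insert_of_mem hq))]
      rintro rfl; exact hp hq
    obtain ⟨c, hc⟩ := crt_one (∏ q ∈ Q, q) p b r.val hpp hcop
    obtain ⟨c1, c2⟩ := (hc c).1 rfl
    refine ⟨c, fun q hq i hdvd => ?_⟩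
    rcases Finset.mem_insert.1 hq with rfl | hq
    · apply hr i
      have h1 : c + h i ≡ c + r.val [MOD q] :=
        (Nat.modEq_zero_iff_dvd.2 hdvd).trans (Nat.modEq_zero_iff_dvd.2 c2).symm
      have h2 := Nat.ModEq.add_left_cancel' c h1
      have h3 := (ZMod.natCast_eq_natCast_iff _ _ _).2 h2
      rw [h3, ZMod.natCast_zmod_val]
    · apply hb q hq i
      have h1 : c + h i ≡ b + h i [MOD q] := (c1.of_dvd (Finset.dvd_prod_of_mem _ hq)).add_right _
      exact (h1.dvd_iff dvd_rfl).1 hdvd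

lemma exists_D (k : ℕ) (h : Fin k → ℕ) (δ : ℝ) (hδ : 0 < δ) :
    ∃ D : ℕ, 1 ≤ D ∧ 2 * k ≤ D ∧ Real.exp (2 * k / D) ≤ 1 + δ ∧ k * (1 + δ) ≤ δ * D ∧ ∀ i, h i ≤ D := by
  obtain ⟨D0, hD0⟩ := exists_nat_ge (max (2 * k / Real.log (1 + δ)) (k * (1 + δ) / δ))
  refine ⟨D0 + 2 * k + 1 + ∑ i, h i, by omega, by omega, ?_, ?_, ?_⟩
  · have hlog : 0 < Real.log (1 + δ) := Real.log_pos (by linarith)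
    have h1 := (le_max_left _ _).trans hD0
    rw [div_le_iff₀ hlog] at h1
    rw [← Real.le_log_iff_exp_le (by linarith), div_le_iff₀ (by positivity)]
    push_cast
    nlinarith [(Nat.cast_nonneg (∑ i, h i) : (0:ℝ) ≤ _), (Nat.cast_nonneg k : (0:ℝ) ≤ k),
      (Finset.sum_nonneg (fun i _ => Nat.cast_nonneg (h i)) : (0:ℝ) ≤ ∑ i, (h i:ℝ))]
  · have h1 := (le_max_right _ _).trans hD0
    rw [div_le_iff₀ hδ] at h1
    have : (D0:ℝ) ≤ ((D0 + 2 * k + 1 + ∑ i, h i : ℕ):ℝ) := by exact_mod_cast (by omega)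
    nlinarith
  · intro i
    have := Finset.single_le_sum (f := h) (fun _ _ => Nat.zero_le _) (Finset.mem_univ i)
    omega

lemma final_ineq (k l : ℕ) (hk : 2 ≤ k) (hl : 1 ≤ l) (N W Φ φW T2 Q1 L lg ρ δ Cp S1m κ : ℝ)
    (hW : 0 < W) (hΦ : 0 < Φ) (hφ : φW = Φ * W) (hN : 0 < N) (hδ : 0 < δ) (hQ1 : 1 ≤ Q1)
    (hL : L = ρ * lg) (hlg : 0 < lg)
    (hκ : κ * ((1 + δ) ^ 4 * ((l + 1) * (k + 2 * l + 1))) = k * ρ * (2 * (2 * l + 1))) (hκ1 : 1 < κ)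
    (hcmp : (2 * l + 1) * (2 * l + 2) * L * Q1 ≤ (1 + δ) ^ 4 * Φ * (k + 2 * l + 1) * T2)
    (hS : S1m = Real.log 3 + lg)
    (hmain : k * (N / φW * (Φ ^ 2 / (l + 1) ^ 2 * T2) - 2 * Cp * N) ≤ S1m * (N / W * Q1) + N)
    (hbig : (2 * k * Cp + 1) * W + Real.log 3 < (κ - 1) * lg) (hpos : 0 ≤ Cp) : False := by
  have hk0 : (0:ℝ) < k := by exact_mod_cast (by omega : 0 < k)
  have e1 : N / φW * (Φ ^ 2 / (l + 1) ^ 2 * T2) = N / W * (Φ * T2 / (l + 1) ^ 2) := by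
    rw [hφ]; field_simp
  rw [e1] at hmain
  have h1 : κ * lg * Q1 ≤ k * (Φ * T2 / (l + 1) ^ 2) := by
    have hX : 0 < (1 + δ) ^ 4 * ((l + 1) * (k + 2 * l + 1)) := by positivity
    rw [← mul_div_assoc, le_div_iff₀ (by positivity)]
    have h3 : (κ * lg * Q1 * (l + 1) ^ 2) * ((1 + δ) ^ 4 * (k + 2 * l + 1)) ≤
       (k * (Φ * T2)) * ((1 + δ) ^ 4 * (k + 2 * l + 1)) := by
      calc _ = (l + 1) * lg * Q1 * (κ * ((1 + δ) ^ 4 * ((l + 1) * (k + 2 * l + 1)))) := by ring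
        _ = k * ((2 * l + 1) * (2 * l + 2) * L * Q1) := by rw [hκ, hL]; ring
        _ ≤ k * ((1 + δ) ^ 4 * Φ * (k + 2 * l + 1) * T2) := mul_le_mul_of_nonneg_left hcmp hk0.le
        _ = _ := by ring
    exact le_of_mul_le_mul_right h3 (by positivity)
  have hNW : 0 < N / W := by positivity
  have h2 := mul_le_mul_of_nonneg_left h1 hNW.le
  have h3 : (N / W) * (Q1 * ((κ - 1) * lg - Real.log 3)) ≤ (2 * k * Cp + 1) * N := by
    rw [hS] at hmain
    nlinarith
  have hY : 0 < (κ - 1) * lg - Real.log 3 := by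
    have : 0 ≤ (2 * k * Cp + 1) * W := by positivity
    linarith
  have h4 : (N / W) * ((2 * k * Cp + 1) * W) < (N / W) * (Q1 * ((κ - 1) * lg - Real.log 3)) := by
    apply mul_lt_mul_of_pos_left _ hNW
    nlinarith
  have h5 : (N / W) * ((2 * k * Cp + 1) * W) = (2 * k * Cp + 1) * N := by field_simp
  linarith

end GPY

open Real Filter

namespace GPY

lemma core (ϑ : ℝ)
    (hlevel : ∀ A > (0 : ℝ), ∀ ε > (0 : ℝ), ∃ C > (0 : ℝ), ∀ x : ℝ, x ≥ 2 →
      ∀ a : ℕ → ℕ, (∀ q, Nat.Coprime (a q) q) →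
        ∑ q ∈ Finset.Icc 1 ⌊x ^ (ϑ - ε)⌋₊,
          |chebyTheta x q (a q) - x / (Nat.totient q)| ≤ C * x / (Real.log x) ^ A)
    (ρ : ℝ) (hρ0 : 0 < ρ) (hρ : ρ < 1 / 2) (hρϑ : 2 * ρ < ϑ) (k l : ℕ) (hk : 2 ≤ k) (hl : 1 ≤ l)
    (hκ0 : (l + 1) * (k + 2 * l + 1) < k * ρ * (2 * (2 * l + 1)))
    (h : Fin k → ℕ) (hinj : Function.Injective h)
    (hadm : ∀ p : ℕ, p.Prime → ∃ r : ZMod p, ∀ i, ((h i : ℕ) : ZMod p) ≠ r) :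
    ∀ᶠ N : ℕ in atTop, ∃ n, N < n ∧ ∃ i j, i ≠ j ∧ (n + h i).Prime ∧ (n + h j).Prime := by
  have hk0 : (2:ℝ) ≤ k := by exact_mod_cast hk
  obtain ⟨δ, hδ, hδκ⟩ : ∃ δ : ℝ, 0 < δ ∧
      (1 + δ) ^ 4 * ((l + 1) * (k + 2 * l + 1)) < k * ρ * (2 * (2 * l + 1)) := by
    have hc : Continuous (fun δ : ℝ => (1 + δ) ^ 4 * (((l:ℝ) + 1) * (k + 2 * l + 1))) := by fun_prop
    have h1 : ∀ᶠ δ in nhds (0:ℝ), (1 + δ) ^ 4 * (((l:ℝ) + 1) * (k + 2 * l + 1)) < k * ρ * (2 * (2 * l + 1)) :=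
      hc.continuousAt.eventually_lt continuousAt_const (by simpa using hκ0)
    have h2 : ∀ᶠ δ in nhdsWithin (0:ℝ) (Set.Ioi 0), _ := nhdsWithin_le_nhds h1
    obtain ⟨δ, h3, h4⟩ := (h2.and self_mem_nhdsWithin).exists
    exact ⟨δ, h4, h3⟩
  have hX : (0:ℝ) < (1 + δ) ^ 4 * ((l + 1) * (k + 2 * l + 1)) := by positivity
  set κ : ℝ := k * ρ * (2 * (2 * l + 1)) / ((1 + δ) ^ 4 * ((l + 1) * (k + 2 * l + 1))) with hκ
  have hκ1 : 1 < κ := by rw [hκ, one_lt_div hX]; exact hδκ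
  have hκe : κ * ((1 + δ) ^ 4 * ((l + 1) * (k + 2 * l + 1))) = k * ρ * (2 * (2 * l + 1)) := by
    rw [hκ, div_mul_cancel₀ _ hX.ne']
  obtain ⟨D, hD1, hD2, hDe, hDδ, hDh⟩ := exists_D k h δ hδ
  set Q := (Finset.range (D + 1)).filter Nat.Prime with hQd
  have hQ : ∀ p ∈ Q, p.Prime := fun p hp => (Finset.mem_filter.1 hp).2
  set W := ∏ p ∈ Q, p with hWd
  have hW : 0 < W := Nat.pos_of_ne_zero (prod_ne_zero_of_prime hQ)
  have hW' : (0:ℝ) < W := by exact_mod_cast hW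
  obtain ⟨b, hb⟩ := exists_b h hadm Q hQ
  have hbW : ∀ i, Nat.Coprime (b + h i) W := by
    intro i
    apply coprime_prod
    intro p hp
    rw [Nat.coprime_comm, (hQ p hp).coprime_iff_not_dvd]
    exact hb p hp i
  set Φ : ℝ := ∏ p ∈ Q, (1 - (p:ℝ)⁻¹) with hΦd
  have hΦ0 : 0 < Φ := Finset.prod_pos fun p hp => one_sub_inv_pos (hQ p hp)
  have hφ : (W.totient:ℝ) = Φ * W := by
    have := totient_WU 1 Q hQ (fun p _ => Nat.coprime_one_left p)
    rw [one_mul, Nat.totient_one, Nat.cast_one, one_mul] at this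
    rw [hWd, this, hΦd]
    push_cast
    rw [← Finset.prod_mul_distrib]
    apply Finset.prod_congr rfl
    intro p hp
    have : (p:ℝ) ≠ 0 := by exact_mod_cast (hQ p hp).ne_zero
    field_simp
  obtain ⟨L0, hL01, hcomp⟩ := compare k l D W hk hl δ hδ hW hD2 hDe hDδ
  obtain ⟨Cp, hCp, herr2⟩ := err2 ϑ hlevel ρ hρ0 hρ hρϑ k l W hW
  filter_upwards [herr2, err1 ρ hρ0 hρ k l, ev_log (L0 / ρ), ev_log 1,
    ev_log (((2 * k * Cp + 1) * W + Real.log 3) / (κ - 1) + 1), eventually_ge_atTop (D + 1)]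
    with N herr2 herr1 hLL hlg1 hbig hND
  have hN0 : 0 < N := by omega
  have hN0' : (0:ℝ) < N := by exact_mod_cast hN0
  set lg := Real.log N with hlg
  set L := ρ * lg with hL
  have hL1 : L0 ≤ L := by rw [div_le_iff₀ hρ0] at hLL; rw [hL]; linarith
  have hL0 : 0 ≤ L := by linarith
  set P := (Finset.Ioc D ⌊Real.exp L⌋₊).filter Nat.Prime with hPd
  have hP : ∀ p ∈ P, p.Prime := fun p hp => (Finset.mem_filter.1 hp).2
  have hPD : ∀ p ∈ P, D < p := fun p hp => (Finset.mem_Ioc.1 (Finset.mem_filter.1 hp).1).1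
  have hPk : ∀ p ∈ P, 2 * k < p := fun p hp => by have := hPD p hp; omega
  have hPh : ∀ p ∈ P, ∀ i, h i < p := fun p hp i => by have := hPD p hp; have := hDh i; omega
  have hQD : ∀ p ∈ Q, p ≤ D := fun p hp => by
    have := Finset.mem_range.1 (Finset.mem_filter.1 hp).1; omega
  have hPW : ∀ p ∈ P, W.Coprime p := by
    intro p hp
    rw [Nat.coprime_comm]
    apply coprime_prod
    intro q hq
    rw [Nat.coprime_primes (hP p hp) (hQ q hq)]
    rintro rfl
    have := hPD p hp; have := hQD p hq; omega
  have hd : Disjoint Q P := by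
    rw [Finset.disjoint_left]
    intro p hq hp
    have := hPD p hp; have := hQD p hq; omega
  have hc : ∀ p : ℕ, p.Prime → (p:ℝ) ≤ Real.exp L → p ∈ Q ∪ P := by
    intro p hp hpL
    rw [Finset.mem_union, hQd, hPd, Finset.mem_filter, Finset.mem_filter, Finset.mem_range, Finset.mem_Ioc]
    by_cases h1 : p ≤ D
    · left; exact ⟨by omega, hp⟩
    · right; exact ⟨⟨by omega, Nat.le_floor hpL⟩, hp⟩
  have hPN : ∀ p ∈ P, p ≤ N := by
    intro p hp
    have h1 := (Finset.mem_Ioc.1 (Finset.mem_filter.1 hp).1).2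
    have h2 := (Nat.le_floor_iff (Real.exp_pos L).le).1 h1
    have h3 : Real.exp L ≤ N := by
      rw [← Real.le_log_iff_exp_le hN0', ← hlg, hL]
      nlinarith
    exact_mod_cast h2.trans h3
  by_contra hno
  push Not at hno
  set w := wt h P (lam k P L l) with hw
  have hw0 : ∀ n, 0 ≤ w n := fun n => by rw [hw]; exact sq_nonneg _
  set X := (Finset.Ioc N (2 * N)).filter (fun n => n ≡ b [MOD W]) with hXd
  set T2 := TT P (fun p => ((k:ℝ) - 1) / (p - k)) L (2 * l + 2) with hT2
  set Q1 := TT P (fun p => (k:ℝ) / (p - k)) L (2 * l) with hQ1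
  have s1 : ∑ n ∈ X, w n ≤ _ := S1_upper (by omega) h hinj W b N hW P hP hPk hPW hPh L hL0 l hl
  have s2 : ∀ i, (N:ℝ) / W.totient * (Φ ^ 2 / (l + 1) ^ 2 * T2) - 2 * Cp * N ≤
      ∑ n ∈ X, (if (n + h i).Prime then Real.log ((n + h i : ℕ):ℝ) else 0) * w n := by
    intro i
    have hhi := hDh i
    obtain ⟨a1, ha1, hm1⟩ := argmax ((2 * N + h i : ℕ):ℝ)
    obtain ⟨a2, ha2, hm2⟩ := argmax ((N + h i : ℕ):ℝ)
    have := S2_lower hk h hinj W b N hW P Q hP hPk hPW hPh L hL0 l hl hQ hd hc hPN i (hbW i) a1 a2 hm1 hm2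
    have e1 := herr2 ((2 * N + h i : ℕ):ℝ) (by exact_mod_cast (by omega)) (by exact_mod_cast (by omega)) a1 ha1 P hP hPW
    have e2 := herr2 ((N + h i : ℕ):ℝ) (by exact_mod_cast (by omega)) (by exact_mod_cast (by omega)) a2 ha2 P hP hPW
    refine le_trans ?_ this
    rw [mul_add]
    linarith
  have s3 : ∀ n ∈ X, ∑ i, (if (n + h i).Prime then Real.log ((n + h i : ℕ):ℝ) else 0) * w n ≤
      Real.log (3 * N) * w n := by
    intro n hn
    obtain ⟨hn1, hn2⟩ := Finset.mem_Ioc.1 (Finset.mem_filter.1 hn).1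
    rw [← Finset.sum_mul]
    apply mul_le_mul_of_nonneg_right _ (hw0 n)
    by_cases hex : ∃ i, (n + h i).Prime
    · obtain ⟨i, hi⟩ := hex
      rw [Finset.sum_eq_single i]
      · rw [if_pos hi]
        apply Real.log_le_log (by exact_mod_cast hi.pos)
        have := hDh i
        exact_mod_cast (by omega)
      · intro j _ hji
        rw [if_neg (hno n hn1 i j hji.symm hi)]
      · intro h; exact absurd (Finset.mem_univ i) h
    · push Not at hex
      rw [Finset.sum_eq_zero (fun i _ => if_neg (hex i))]
      apply Real.log_nonneg
      have : (1:ℝ) ≤ N := by exact_mod_cast hN0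
      linarith
  have hS : Real.log (3 * N) = Real.log 3 + lg := Real.log_mul (by norm_num) hN0'.ne'
  have hlog0 : 0 ≤ Real.log (3 * N) := by
    rw [hS]; have := Real.log_nonneg (by norm_num : (1:ℝ) ≤ 3); linarith
  have s4 : k * ((N:ℝ) / W.totient * (Φ ^ 2 / (l + 1) ^ 2 * T2) - 2 * Cp * N) ≤
      Real.log (3 * N) * ((N:ℝ) / W * Q1) + N := by
    calc _ = ∑ i : Fin k, ((N:ℝ) / W.totient * (Φ ^ 2 / (l + 1) ^ 2 * T2) - 2 * Cp * N) := by
          rw [Finset.sum_const, Finset.card_univ, Fintype.card_fin, nsmul_eq_mul]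
      _ ≤ ∑ i : Fin k, ∑ n ∈ X, (if (n + h i).Prime then Real.log ((n + h i : ℕ):ℝ) else 0) * w n :=
          Finset.sum_le_sum fun i _ => s2 i
      _ = ∑ n ∈ X, ∑ i : Fin k, (if (n + h i).Prime then Real.log ((n + h i : ℕ):ℝ) else 0) * w n := Finset.sum_comm
      _ ≤ ∑ n ∈ X, Real.log (3 * N) * w n := Finset.sum_le_sum s3
      _ = Real.log (3 * N) * ∑ n ∈ X, w n := by rw [Finset.mul_sum]
      _ ≤ _ := mul_le_mul_of_nonneg_left s1 hlog0
      _ ≤ _ := by rw [mul_add]; linarith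
  have hQ11 : 1 ≤ Q1 := by
    have h1 := TT_lower P (fun p => (k:ℝ) / (p - k)) (fun p hp => by
      have h2 : (2:ℝ) * k < p := by exact_mod_cast hPk p hp
      apply div_nonneg <;> linarith) L hL0 (2 * l)
    exact (one_le_pow₀ (by linarith)).trans h1
  have hcmp := hcomp L hL1 P hP hPD hPW
  have hΦe : (W.totient:ℝ) / W = Φ := by rw [hφ]; field_simp
  rw [hΦe] at hcmp
  refine final_ineq k l hk hl N W Φ W.totient T2 Q1 L lg ρ δ Cp _ κ hW' hΦ0 hφ hN0' hδ hQ11 hL (by linarith)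
    hκe hκ1 hcmp hS s4 ?_ hCp.le
  have h1 : ((2 * k * Cp + 1) * W + Real.log 3) / (κ - 1) < lg := by linarith
  rw [div_lt_iff₀ (by linarith)] at h1
  linarith

end GPY

/-- (Goldston–Pintz–Yildirim, Theorem 3.3) If the primes have an admissible level of
distribution `ϑ > 1/2`, then there is a constant `C(ϑ)` such that every admissible
`k`-tuple with `k ≥ C(ϑ)` contains at least two primes infinitely often. -/
theorem goldston_pintz_yildirim_two_primes
    (ϑ : ℝ) (hϑ : ϑ > 1 / 2)
    (hlevel : ∀ A > (0 : ℝ), ∀ ε > (0 : ℝ), ∃ C > (0 : ℝ), ∀ x : ℝ, x ≥ 2 →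
      ∀ a : ℕ → ℕ, (∀ q, Nat.Coprime (a q) q) →
        ∑ q ∈ Finset.Icc 1 ⌊x ^ (ϑ - ε)⌋₊,
          |chebyTheta x q (a q) - x / (Nat.totient q)| ≤ C * x / (Real.log x) ^ A) :
    ∃ C : ℕ, ∀ k : ℕ, k ≥ C → ∀ h : Fin k → ℤ, Function.Injective h →
      AdmissibleTuple h →
      {n : ℕ | ∃ i j : Fin k, i ≠ j ∧
        Prime ((n : ℤ) + h i) ∧ Prime ((n : ℤ) + h j)}.Infinite := by
  obtain ⟨ρ, hρ1, hρ2⟩ := exists_between (show (1/4:ℝ) < min (ϑ / 2) (1 / 2) from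
    lt_min (by linarith) (by norm_num))
  have hρ3 : ρ < ϑ / 2 := hρ2.trans_le (min_le_left _ _)
  have hρ4 : ρ < 1 / 2 := hρ2.trans_le (min_le_right _ _)
  obtain ⟨l0, hl0⟩ := exists_nat_ge (1 / (4 * ρ - 1))
  rw [div_le_iff₀ (by linarith)] at hl0
  obtain ⟨l, hl1, hl⟩ : ∃ l : ℕ, 1 ≤ l ∧ 0 < 2 * ρ * (2 * l + 1) - (l + 1) := by
    refine ⟨l0 + 1, by omega, ?_⟩
    push_cast
    nlinarith
  obtain ⟨C0, hC0⟩ := exists_nat_gt (((l:ℝ) + 1) * (2 * l + 1) / (2 * ρ * (2 * l + 1) - (l + 1)))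
  rw [div_lt_iff₀ hl] at hC0
  refine ⟨C0 + 2, fun k hk h hinj hadm => ?_⟩
  have hkC : (C0:ℝ) ≤ k := by exact_mod_cast (by omega)
  set c : ℕ := ∑ i, (h i).natAbs with hc
  have hci : ∀ i, 0 ≤ h i + c := by
    intro i
    have h1 := Finset.single_le_sum (f := fun i => (h i).natAbs) (fun _ _ => Nat.zero_le _) (Finset.mem_univ i)
    have h2 : (h i).natAbs ≤ c := h1
    omega
  have hcast : ∀ i, ((h i + c).toNat : ℤ) = h i + c := fun i => Int.toNat_of_nonneg (hci i)
  have key := GPY.core ϑ hlevel ρ (by linarith) hρ4 (by linarith) k l (by omega) hl1 (by nlinarith)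
    (fun i => (h i + c).toNat) (by
      intro i j hij
      have h1 : (((h i + c).toNat : ℕ) : ℤ) = (((h j + c).toNat : ℕ) : ℤ) := congrArg _ hij
      rw [hcast, hcast] at h1
      exact hinj (by linarith)) (by
      intro p hp
      obtain ⟨r, hr⟩ := hadm p hp
      refine ⟨r + c, fun i hi => hr i ?_⟩
      have h1 : (((h i + c).toNat : ℕ) : ZMod p) = ((((h i + c).toNat : ℕ) : ℤ) : ZMod p) := by push_cast; rfl
      rw [h1, hcast] at hi
      push_cast at hi
      exact add_right_cancel hi)
  obtain ⟨N0, hN0⟩ := eventually_atTop.1 key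
  apply Set.infinite_of_forall_exists_gt
  intro M
  obtain ⟨n, hn, i, j, hij, hi, hj⟩ := hN0 (max N0 M) (le_max_left _ _)
  refine ⟨n + c, ⟨i, j, hij, ?_, ?_⟩, ?_⟩
  · have : ((n + c : ℕ) : ℤ) + h i = ((n + (h i + c).toNat : ℕ) : ℤ) := by
      push_cast [hcast]; ring
    rw [this]; exact Nat.prime_iff_prime_int.1 hi
  · have : ((n + c : ℕ) : ℤ) + h j = ((n + (h j + c).toNat : ℕ) : ℤ) := by
      push_cast [hcast]; ring
    rw [this]; exact Nat.prime_iff_prime_int.1 hj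
  · have := le_max_right N0 M; omega
end

section
/- (Rankin's trick, smooth number bound) For all real x ≥ 1, y ≥ 2 and every η > 0, the number of positive integers m ≤ x all of whose prime factors are at most y satisfies #{m ∈ ℕ : 1 ≤ m ≤ x, every prime p dividing m satisfies p ≤ y} ≤ x^η · ∏_{p ≤ y, p prime} (1 − p^{−η})^{−1}. -/
open Real Finset

open Classical in
/-- (Rankin's trick) For `x ≥ 1`, `y ≥ 2` and `η > 0`, the number of `y`-smooth integers
`m ≤ x` is at most `x^η · ∏_{p ≤ y} (1 - p^{-η})⁻¹`. -/
theorem rankin_trick_smooth_bound (x y η : ℝ) (hx : 1 ≤ x) (hy : 2 ≤ y) (hη : 0 < η) :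
    (((Finset.Icc 1 ⌊x⌋₊).filter
        (fun m => ∀ p : ℕ, p.Prime → p ∣ m → (p : ℝ) ≤ y)).card : ℝ) ≤
      x ^ η * ∏ p ∈ (Finset.Iic ⌊y⌋₊).filter Nat.Prime, (1 - (p : ℝ) ^ (-η))⁻¹ := by
  let f : ℕ →* ℝ :=
    { toFun := fun n => (n : ℝ) ^ (-η)
      map_one' := by simp
      map_mul' := fun a b => by
        push_cast
        exact Real.mul_rpow (Nat.cast_nonneg a) (Nat.cast_nonneg b) }
  have hf : ∀ n : ℕ, f n = (n : ℝ) ^ (-η) := fun n => rfl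
  have hf0 : ∀ n : ℕ, 0 ≤ f n := fun n => by rw [hf]; positivity
  have h1 : ∀ {p : ℕ}, p.Prime → ‖f p‖ < 1 := by
    intro p hp
    rw [Real.norm_of_nonneg (hf0 p), hf]
    exact Real.rpow_lt_one_of_one_lt_of_neg (by exact_mod_cast hp.one_lt) (by linarith)
  have h2 := (EulerProduct.summable_and_hasSum_factoredNumbers_prod_filter_prime_geometric
    h1 (Finset.Iic ⌊y⌋₊)).2
  have h3 : HasSum ((Nat.factoredNumbers (Finset.Iic ⌊y⌋₊)).indicator (fun m => f m)) _ :=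
    hasSum_subtype_iff_indicator.mp h2
  set S := (Finset.Icc 1 ⌊x⌋₊).filter
        (fun m => ∀ p : ℕ, p.Prime → p ∣ m → (p : ℝ) ≤ y) with hS
  have h4 := sum_le_hasSum S
    (fun i _ => Set.indicator_nonneg (fun m _ => hf0 m) i) h3
  have hx0 : (0 : ℝ) < x := by linarith
  have h5 : (S.card : ℝ) ≤ x ^ η * ∑ m ∈ S,
      (Nat.factoredNumbers (Finset.Iic ⌊y⌋₊)).indicator (fun m => f m) m := by
    rw [Finset.mul_sum, Finset.card_eq_sum_ones, Nat.cast_sum]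
    apply Finset.sum_le_sum
    intro m hm
    rw [hS, Finset.mem_filter, Finset.mem_Icc] at hm
    obtain ⟨⟨hm1, hmx⟩, hmp⟩ := hm
    have hmem : m ∈ Nat.factoredNumbers (Finset.Iic ⌊y⌋₊) := by
      rw [Nat.mem_factoredNumbers']
      intro p hp hd
      rw [Finset.mem_Iic]
      exact Nat.le_floor (hmp p hp hd)
    rw [Set.indicator_of_mem hmem, hf]
    have hm0 : (0 : ℝ) < m := by exact_mod_cast hm1
    have hmx' : (m : ℝ) ≤ x := (Nat.le_floor_iff hx0.le).mp hmx
    rw [Real.rpow_neg hm0.le, ← div_eq_mul_inv, Nat.cast_one,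
      one_le_div (Real.rpow_pos_of_pos hm0 η)]
    exact Real.rpow_le_rpow hm0.le hmx' hη.le
  refine h5.trans (mul_le_mul_of_nonneg_left ?_ (Real.rpow_nonneg hx0.le η))
  convert h4 using 2
  rw [hf]
end
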